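/- arXiv:2109.01041 — 2 statements merged into one kernel-verified Lean document; each statement's English description precedes it below -/
import Mathlib

section
/- Let d ≥ 2 and let P, Q be Borel probability measures on ℝ^d. Assume that the absolute moments m_N := ∫ ‖x‖^N dP(x) are finite for all N ≥ 1 and satisfy the Carleman condition ∑_{N≥1} m_N^{-1/N} = ∞. If the set E(P,Q) has positive Lebesgue measure in ℝ^d, then P = Q. -/
open MeasureTheory
open scoped RealInnerProductSpace

/-- The characteristic function `φ_P(y) := ∫ exp(i⟨y,z⟩) dP(z)` of a Borel probability
measure `P` on `ℝ^d`. -/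
noncomputable def charFn {d : ℕ} (P : Measure (EuclideanSpace ℝ (Fin d)))
    (y : EuclideanSpace ℝ (Fin d)) : ℂ :=
  ∫ z, Complex.exp ((⟪y, z⟫ : ℝ) * Complex.I) ∂P



lemma bang_step (f : ℕ → ℝ → ℂ) (M : ℕ → ℝ) (hM : ∀ n, 0 < M n)
    (hlc : ∀ n, M (n + 1) ^ 2 ≤ M n * M (n + 2))
    (hder : ∀ n t, HasDerivAt (f n) (f (n + 1) t) t)
    (hb : ∀ n t, ‖f n t‖ ≤ M n) (k : ℕ) (x h : ℝ) (hh : 0 ≤ h)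
    (hhk : h ≤ M k / M (k + 1) / Real.exp 1)
    (hx : ∀ n, ‖f n x‖ ≤ Real.exp ((n : ℝ) - (k + 1 : ℕ)) * M n) :
    ∀ n, ‖f n (x + h)‖ ≤ Real.exp ((n : ℝ) - k) * M n := by
  have hanti : Antitone (fun n => M n / M (n + 1)) := by
    apply antitone_nat_of_succ_le
    intro n
    rw [div_le_div_iff₀ (hM _) (hM _)]
    have := hlc n
    nlinarith
  set c : ℝ := Real.exp 1 * (M (k + 1) / M k) with hc
  have hcpos : 0 < c := mul_pos (Real.exp_pos _) (div_pos (hM _) (hM _))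
  have hch : c * h ≤ 1 := by
    have h1 : c * h ≤ c * (M k / M (k + 1) / Real.exp 1) := by gcongr
    have h2 : c * (M k / M (k + 1) / Real.exp 1) = 1 := by
      have := (hM k).ne'
      have := (hM (k + 1)).ne'
      have := (Real.exp_pos 1).ne'
      rw [hc]; field_simp
    linarith
  -- main downward induction
  have key : ∀ j n, n + j = k + 1 → ∀ s ∈ Set.Icc x (x + h),
      ‖f n s‖ ≤ Real.exp ((n : ℝ) - (k + 1 : ℕ)) * M n * Real.exp (c * (s - x)) := by
    intro j
    induction j with
    | zero =>
      intro n hn s hs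
      obtain rfl : n = k + 1 := by omega
      rw [sub_self, Real.exp_zero, one_mul]
      refine (hb _ s).trans (le_mul_of_one_le_right (hM _).le ?_)
      apply Real.one_le_exp
      exact mul_nonneg hcpos.le (by linarith [hs.1])
    | succ j ih =>
      intro n hn
      have ih' := ih (n + 1) (by omega)
      have hnk : n ≤ k := by omega
      have hB : ∀ s, HasDerivAt
          (fun s => Real.exp ((n : ℝ) - (k + 1 : ℕ)) * M n * Real.exp (c * (s - x)))
          (Real.exp ((n : ℝ) - (k + 1 : ℕ)) * M n * (Real.exp (c * (s - x)) * c)) s := by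
        intro s
        have h1 : HasDerivAt (fun s => c * (s - x)) c s := by
          simpa using ((hasDerivAt_id s).sub_const x).const_mul c
        exact h1.exp.const_mul _
      apply image_norm_le_of_norm_deriv_right_le_deriv_boundary' (f' := f (n + 1))
        (f := f n) (a := x) (b := x + h)
        (B := fun s => Real.exp ((n : ℝ) - (k + 1 : ℕ)) * M n * Real.exp (c * (s - x)))
        (B' := fun s => Real.exp ((n : ℝ) - (k + 1 : ℕ)) * M n * (Real.exp (c * (s - x)) * c))
      · exact fun s _ => (hder n s).continuousAt.continuousWithinAt
      · exact fun s _ => (hder n s).hasDerivWithinAt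
      · simpa using hx n
      · exact fun s _ => (hB s).continuousAt.continuousWithinAt
      · exact fun s _ => (hB s).hasDerivWithinAt
      · intro s hs
        refine (ih' s ⟨hs.1, hs.2.le⟩).trans ?_
        have e1 : Real.exp (((n + 1 : ℕ) : ℝ) - (k + 1 : ℕ))
            = Real.exp ((n : ℝ) - (k + 1 : ℕ)) * Real.exp 1 := by
          rw [← Real.exp_add]; congr 1; push_cast; ring
        have e2 : M (n + 1) ≤ M n * (M (k + 1) / M k) := by
          have := hanti hnk
          simp only at this
          rw [div_le_div_iff₀ (hM _) (hM _)] at this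
          rw [← mul_div_assoc, le_div_iff₀ (hM _)]
          linarith
        rw [e1]
        calc _ ≤ Real.exp ((n : ℝ) - (k + 1 : ℕ)) * Real.exp 1 * (M n * (M (k + 1) / M k))
              * Real.exp (c * (s - x)) := by gcongr
          _ = _ := by rw [hc]; ring
  intro n
  rcases le_or_gt n (k + 1) with hn | hn
  · refine (key (k + 1 - n) n (by omega) (x + h) ⟨by linarith, le_rfl⟩).trans ?_
    have e1 : Real.exp ((n : ℝ) - k) = Real.exp ((n : ℝ) - (k + 1 : ℕ)) * Real.exp 1 := by
      rw [← Real.exp_add]; congr 1; push_cast; ring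
    have e2 : Real.exp (c * (x + h - x)) ≤ Real.exp 1 := by
      apply Real.exp_le_exp.2; simpa using hch
    rw [e1]
    have := hM n
    calc _ ≤ Real.exp ((n : ℝ) - (k + 1 : ℕ)) * M n * Real.exp 1 := by gcongr
      _ = _ := by ring
  · refine (hb n _).trans (le_mul_of_one_le_left (hM n).le ?_)
    apply Real.one_le_exp
    have : (k : ℝ) ≤ n := by exact_mod_cast (by omega : k ≤ n)
    linarith

lemma bang (f : ℕ → ℝ → ℂ) (M : ℕ → ℝ) (hM : ∀ n, 0 < M n)
    (hlc : ∀ n, M (n + 1) ^ 2 ≤ M n * M (n + 2))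
    (hder : ∀ n t, HasDerivAt (f n) (f (n + 1) t) t)
    (hb : ∀ n t, ‖f n t‖ ≤ M n) (h0 : ∀ n, f n 0 = 0)
    (hns : ¬ Summable (fun n => M n / M (n + 1))) (x : ℝ) (hx : 0 ≤ x) : f 0 x = 0 := by
  have key : ∀ j k x, 0 ≤ x →
      x ≤ ∑ i ∈ Finset.range j, M (k + i) / M (k + i + 1) / Real.exp 1 →
      ∀ n, ‖f n x‖ ≤ Real.exp ((n : ℝ) - k) * M n := by
    intro j
    induction j with
    | zero =>
      intro k x hx hx' n
      obtain rfl : x = 0 := le_antisymm (by simpa using hx') hx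
      rw [h0, norm_zero]
      exact mul_nonneg (Real.exp_pos _).le (hM n).le
    | succ j ih =>
      intro k x hx hx'
      rw [Finset.sum_range_succ'] at hx'
      have hr : 0 < M k / M (k + 1) / Real.exp 1 :=
        div_pos (div_pos (hM _) (hM _)) (Real.exp_pos _)
      have h1 := ih (k + 1) (max 0 (x - M k / M (k + 1) / Real.exp 1)) (le_max_left _ _) (by
        apply max_le
        · exact Finset.sum_nonneg fun i _ =>
            (div_pos (div_pos (hM _) (hM _)) (Real.exp_pos _)).le
        · rw [sub_le_iff_le_add]
          refine hx'.trans (le_of_eq ?_)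
          simp only [add_zero]
          congr 1
          refine Finset.sum_congr rfl fun i _ => ?_
          rw [show k + (i + 1) = k + 1 + i by ring])
      have := bang_step f M hM hlc hder hb k _ (x - max 0 (x - M k / M (k + 1) / Real.exp 1))
        (by simpa using ⟨hx, hr.le⟩)
        (by linarith [le_max_right 0 (x - M k / M (k + 1) / Real.exp 1)]) h1
      simpa using this
  have hall : ∀ k : ℕ, ‖f 0 x‖ ≤ Real.exp (-(k : ℝ)) * M 0 := by
    intro k
    have hns' : ¬ Summable (fun i => M (k + i) / M (k + i + 1) / Real.exp 1) := by
      intro hs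
      apply hns
      have := hs.mul_right (Real.exp 1)
      simp only [div_mul_cancel₀ _ (Real.exp_pos 1).ne'] at this
      rw [← summable_nat_add_iff k]
      simpa [add_comm, add_left_comm, add_assoc] using this
    rw [not_summable_iff_tendsto_nat_atTop_of_nonneg (fun i =>
      (div_pos (div_pos (hM _) (hM _)) (Real.exp_pos _)).le)] at hns'
    obtain ⟨j, hj⟩ := (hns'.eventually_ge_atTop x).exists
    simpa using key j k x hx hj 0
  have hlim : Filter.Tendsto (fun k : ℕ => Real.exp (-(k : ℝ)) * M 0) Filter.atTop (nhds 0) := by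
    have := (Real.tendsto_exp_neg_atTop_nhds_zero.comp
      (tendsto_natCast_atTop_atTop (R := ℝ))).mul_const (M 0)
    simpa using this
  have := ge_of_tendsto' hlim hall
  exact norm_le_zero_iff.1 this

/-- Carleman's inequality (summability form). -/
lemma carleman_summable (r : ℕ → ℝ) (hr : ∀ n, 0 ≤ r n) (hs : Summable r) :
    Summable (fun n : ℕ => (∏ i ∈ Finset.range (n + 1), r i) ^ (1 / ((n : ℝ) + 1))) := by
  set T : ℕ → ℝ := fun n => ∑ i ∈ Finset.range n, ((i : ℝ) + 1) * r i with hT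
  have hT0 : ∀ n, 0 ≤ T n := fun n => Finset.sum_nonneg fun i _ => mul_nonneg (by positivity) (hr i)
  have htel : ∀ K : ℕ, ∑ n ∈ Finset.range K, T (n + 1) / (((n : ℝ) + 1) * (n + 2)) + T K / (K + 1)
      = ∑ n ∈ Finset.range K, r n := by
    intro K
    induction K with
    | zero => simp [hT]
    | succ K ih =>
      rw [Finset.sum_range_succ, Finset.sum_range_succ _ K, ← ih]
      have : T (K + 1) = T K + (K + 1) * r K := by simp [hT, Finset.sum_range_succ]
      rw [this]; push_cast; field_simp; ring
  have hsT : Summable (fun n : ℕ => T (n + 1) / (((n : ℝ) + 1) * (n + 2))) := by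
    refine summable_of_sum_range_le (c := ∑' n, r n)
      (fun n => div_nonneg (hT0 _) (by positivity)) fun K => ?_
    have h1 := htel K
    have h2 : 0 ≤ T K / (K + 1) := div_nonneg (hT0 _) (by positivity)
    have h3 := hs.sum_le_tsum (Finset.range K) (fun i _ => hr i)
    linarith
  refine Summable.of_nonneg_of_le (fun n => Real.rpow_nonneg (Finset.prod_nonneg fun i _ => hr i) _)
    (fun n => ?_) (hsT.mul_left (2 * Real.exp 1))
  have amgm := Real.geom_mean_le_arith_mean_weighted (Finset.range (n + 1))
    (fun _ => 1 / ((n : ℝ) + 1)) (fun i => ((i : ℝ) + 1) * r i) (fun i _ => by positivity)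
    (by simp; field_simp) (fun i _ => mul_nonneg (by positivity) (hr i))
  rw [Real.finsetProd_rpow _ _ (fun i _ => mul_nonneg (by positivity) (hr i)),
    Finset.prod_mul_distrib, ← Finset.mul_sum] at amgm
  have hfac : ∏ i ∈ Finset.range (n + 1), ((i : ℝ) + 1) = ((n + 1).factorial : ℝ) := by
    rw [← Finset.prod_range_add_one_eq_factorial]; push_cast; rfl
  rw [hfac, Real.mul_rpow (by positivity) (Finset.prod_nonneg fun i _ => hr i)] at amgm
  have hst : ((n : ℝ) + 1) / Real.exp 1 ≤ ((n + 1).factorial : ℝ) ^ (1 / ((n : ℝ) + 1)) := by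
    have h1 := Real.pow_div_factorial_le_exp (x := (n : ℝ) + 1) (by positivity) (n + 1)
    have h2 : (((n : ℝ) + 1) / Real.exp 1) ^ (n + 1) ≤ ((n + 1).factorial : ℝ) := by
      rw [div_pow, ← Real.exp_nat_mul, div_le_iff₀ (Real.exp_pos _)]
      rw [div_le_iff₀ (by positivity)] at h1
      push_cast
      rw [mul_one]
      linarith
    calc ((n : ℝ) + 1) / Real.exp 1
        = ((((n : ℝ) + 1) / Real.exp 1) ^ (n + 1)) ^ (1 / ((n : ℝ) + 1)) := by
          rw [← Real.rpow_natCast, ← Real.rpow_mul (by positivity)]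
          push_cast
          rw [mul_one_div_cancel (by positivity), Real.rpow_one]
      _ ≤ _ := Real.rpow_le_rpow (by positivity) h2 (by positivity)
  set G := (∏ i ∈ Finset.range (n + 1), r i) ^ (1 / ((n : ℝ) + 1)) with hG
  have hG0 : 0 ≤ G := Real.rpow_nonneg (Finset.prod_nonneg fun i _ => hr i) _
  have h3 : ((n : ℝ) + 1) / Real.exp 1 * G ≤ 1 / ((n : ℝ) + 1) * T (n + 1) :=
    (mul_le_mul_of_nonneg_right hst hG0).trans amgm
  have hTn := hT0 (n + 1)
  have h4 : G ≤ Real.exp 1 * (T (n + 1) / (((n : ℝ) + 1) * (n + 1))) := by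
    have : G = Real.exp 1 / ((n : ℝ) + 1) * (((n : ℝ) + 1) / Real.exp 1 * G) := by field_simp
    rw [this]
    calc _ ≤ Real.exp 1 / ((n : ℝ) + 1) * (1 / ((n : ℝ) + 1) * T (n + 1)) := by gcongr
      _ = _ := by field_simp
  refine h4.trans ?_
  have h5 : T (n + 1) / (((n : ℝ) + 1) * (n + 1)) ≤ 2 * (T (n + 1) / (((n : ℝ) + 1) * (n + 2))) := by
    rw [← mul_div_assoc, div_le_div_iff₀ (by positivity) (by positivity)]
    have : 0 ≤ T (n + 1) * ((n + 1) * n) := by positivity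
    nlinarith
  calc _ ≤ Real.exp 1 * (2 * (T (n + 1) / (((n : ℝ) + 1) * (n + 2)))) := by gcongr
    _ = _ := by ring

lemma moment_logconvex {α : Type*} [MeasurableSpace α] (μ : Measure α) (g : α → ℝ)
    (hg0 : ∀ x, 0 ≤ g x) (hg : ∀ n : ℕ, Integrable (fun x => g x ^ n) μ) (n : ℕ) :
    (∫ x, g x ^ (n + 1) ∂μ) ^ 2 ≤ (∫ x, g x ^ n ∂μ) * ∫ x, g x ^ (n + 2) ∂μ := by
  have := discrim_le_zero (a := ∫ x, g x ^ n ∂μ) (b := -2 * ∫ x, g x ^ (n + 1) ∂μ)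
    (c := ∫ x, g x ^ (n + 2) ∂μ) (fun t => by
      have h : (∫ x, g x ^ n ∂μ) * (t * t) + (-2 * ∫ x, g x ^ (n + 1) ∂μ) * t
          + ∫ x, g x ^ (n + 2) ∂μ = ∫ x, g x ^ n * (t - g x) ^ 2 ∂μ := by
        have e : (fun x => g x ^ n * (t - g x) ^ 2) = fun x =>
            (t * t) * g x ^ n + (-2 * t) * g x ^ (n + 1) + g x ^ (n + 2) := by
          funext x; ring
        have i1 : Integrable (fun x => (t * t) * g x ^ n + (-2 * t) * g x ^ (n + 1)) μ :=
          ((hg n).const_mul _).add ((hg (n + 1)).const_mul _)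
        rw [e, integral_add i1 (hg (n + 2)),
          integral_add ((hg n).const_mul _) ((hg (n + 1)).const_mul _),
          integral_const_mul, integral_const_mul]
        ring
      rw [h]
      exact integral_nonneg fun x => mul_nonneg (pow_nonneg (hg0 x) _) (sq_nonneg _))
  unfold discrim at this
  nlinarith

theorem carleman_1d (p q : Measure ℝ) [IsProbabilityMeasure p] [IsProbabilityMeasure q]
    (hp : ∀ n : ℕ, MemLp id n p) (hq : ∀ n : ℕ, MemLp id n q)
    (heq : ∀ n : ℕ, ∫ y, y ^ n ∂p = ∫ y, y ^ n ∂q)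
    (hC : (∫ y, y ^ 2 ∂p ≠ 0) → ¬ Summable (fun k : ℕ =>
      (∫ y, |y| ^ (2 * k + 2) ∂p) ^ (-1 / (2 * (k : ℝ) + 2)))) :
    charFun p 1 = charFun q 1 := by
  have ip : ∀ n : ℕ, Integrable (fun y => |y| ^ n) p := fun n => by
    simpa using (hp n).integrable_norm_pow'
  have iq : ∀ n : ℕ, Integrable (fun y => |y| ^ n) q := fun n => by
    simpa using (hq n).integrable_norm_pow'
  have triv : ∀ μ : Measure ℝ, IsProbabilityMeasure μ → Integrable (fun y => |y| ^ 2) μ →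
      ∫ y, y ^ 2 ∂μ = 0 → charFun μ 1 = 1 := by
    intro μ _ hi h0
    have := (integral_eq_zero_iff_of_nonneg (fun y => sq_nonneg y) (by simpa using hi)).1 h0
    rw [charFun_apply_real]
    have h1 : ∫ x : ℝ, Complex.exp (((1 : ℝ) : ℂ) * x * Complex.I) ∂μ = ∫ x : ℝ, (1 : ℂ) ∂μ := by
      apply integral_congr_ae
      filter_upwards [this] with y hy
      have : y = 0 := by simpa using hy
      simp [this]
    rw [h1]; simp
  by_cases hz : ∫ y, y ^ 2 ∂p = 0
  · rw [triv p inferInstance (ip 2) hz, triv q inferInstance (iq 2) (heq 2 ▸ hz)]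
  have hC := hC hz
  set M : ℕ → ℝ := fun n => ∫ y, |y| ^ n ∂(p + q) with hMdef
  have ipq : ∀ n : ℕ, Integrable (fun y => |y| ^ n) (p + q) := fun n => (ip n).add_measure (iq n)
  have hMadd : ∀ n, M n = ∫ y, |y| ^ n ∂p + ∫ y, |y| ^ n ∂q := fun n =>
    integral_add_measure (ip n) (iq n)
  have hM : ∀ n, 0 < M n := by
    intro n
    have h0 : 0 ≤ M n := integral_nonneg fun y => by positivity
    refine lt_of_le_of_ne h0 fun h => hz ?_
    have := (integral_eq_zero_iff_of_nonneg (fun y => pow_nonneg (abs_nonneg y) n) (ip n)).1 (by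
      have h1 := hMadd n
      have h2 : 0 ≤ ∫ y, |y| ^ n ∂p := integral_nonneg fun y => by positivity
      have h3 : 0 ≤ ∫ y, |y| ^ n ∂q := integral_nonneg fun y => by positivity
      linarith)
    rw [integral_congr_ae (g := fun _ => 0)]
    · simp
    · filter_upwards [this] with y hy
      have : |y| = 0 := eq_zero_of_pow_eq_zero hy
      simp [abs_eq_zero.1 this]
  have hlc := moment_logconvex (p + q) (fun y => |y|) (fun y => abs_nonneg y) ipq
  set f : ℕ → ℝ → ℂ := fun n t => iteratedDeriv n (charFun p) t - iteratedDeriv n (charFun q) t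
  have hfb : ∀ (μ : Measure ℝ) [IsProbabilityMeasure μ], (∀ n : ℕ, MemLp id n μ) → ∀ (n : ℕ) (t : ℝ),
      ‖iteratedDeriv n (charFun μ) t‖ ≤ ∫ y, |y| ^ n ∂μ := by
    intro μ _ hμ n t
    rw [iteratedDeriv_charFun (hμ n), norm_mul, norm_pow, Complex.norm_I, one_pow, one_mul]
    refine (norm_integral_le_integral_norm _).trans (le_of_eq ?_)
    congr 1
    funext y
    rw [norm_mul, norm_pow, Complex.norm_real, Real.norm_eq_abs,
      show (t : ℂ) * y * Complex.I = ((t * y : ℝ) : ℂ) * Complex.I by push_cast; ring,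
      Complex.norm_exp_ofReal_mul_I, mul_one]
  have hfd : ∀ (μ : Measure ℝ) [IsProbabilityMeasure μ], (∀ n : ℕ, MemLp id n μ) → ∀ (n : ℕ) (t : ℝ),
      HasDerivAt (iteratedDeriv n (charFun μ)) (iteratedDeriv (n + 1) (charFun μ) t) t := by
    intro μ _ hμ n t
    rw [iteratedDeriv_succ]
    apply DifferentiableAt.hasDerivAt
    exact (contDiff_charFun' (n := ⊤) hμ).differentiable_iteratedDeriv n (by exact_mod_cast WithTop.coe_lt_top n) t
  have := bang f M hM hlc (fun n t => (hfd p hp n t).sub (hfd q hq n t))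
    (fun n t => (norm_sub_le _ _).trans (by
      rw [hMadd]; exact add_le_add (hfb p hp n t) (hfb q hq n t)))
    (fun n => by
      simp only [f]
      rw [iteratedDeriv_charFun_zero (hp n), iteratedDeriv_charFun_zero (hq n)]
      have h1 := heq n
      simp [h1])
    (fun hs => hC (by
      have hs' := carleman_summable _ (fun n => (div_pos (hM n) (hM (n + 1))).le) hs
      have hs'' := hs'.comp_injective (i := fun k : ℕ => 2 * k + 1) (fun a b h => by simpa using h)
      refine hs''.congr fun k => ?_
      simp only [Function.comp]
      have hprod : ∀ m, ∏ i ∈ Finset.range m, M i / M (i + 1) = M 0 / M m := by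
        intro m
        induction m with
        | zero => simp [(hM 0).ne']
        | succ m ih =>
          rw [Finset.prod_range_succ, ih, div_mul_div_cancel₀ (hM m).ne']
      rw [hprod]
      have e0 : M 0 = 2 := by rw [hMadd]; simp; norm_num
      have e1 : M (2 * k + 1 + 1) = 2 * ∫ y, |y| ^ (2 * k + 2) ∂p := by
        rw [hMadd]
        have : ∀ μ : Measure ℝ, ∫ y, |y| ^ (2 * k + 1 + 1) ∂μ = ∫ y, y ^ (2 * k + 2) ∂μ := by
          intro μ; congr 1; funext y
          exact Even.pow_abs ⟨k + 1, by ring⟩ y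
        have h2 : ∫ y, |y| ^ (2 * k + 2) ∂p = ∫ y, y ^ (2 * k + 2) ∂p := this p
        rw [this, this, ← heq]; ring
      have e2 : 0 ≤ ∫ y, |y| ^ (2 * k + 2) ∂p := integral_nonneg fun y => by positivity
      rw [e0, e1, mul_comm, div_mul_cancel_right₀ two_ne_zero, Real.inv_rpow e2,
        ← Real.rpow_neg e2]
      congr 1
      push_cast
      ring)) 1 zero_le_one
  simpa [f, sub_eq_zero] using this

lemma final_ineq (A b X : ℝ) (k : ℕ) (hA0 : 0 < A) (hb : 0 < b) (hX : 0 < X)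
    (hAle : A ≤ X ^ (2 * k + 2) * b) :
    b ^ (-1 / (((2 * k + 1 : ℕ) : ℝ) + 1)) ≤ X * A ^ (-1 / (2 * (k : ℝ) + 2)) := by
  rw [← Real.log_le_log_iff (by positivity) (by positivity), Real.log_mul (by positivity)
    (by positivity), Real.log_rpow hb, Real.log_rpow hA0]
  rw [← Real.log_le_log_iff (by positivity) (by positivity), Real.log_mul (by positivity)
    (by positivity), Real.log_pow] at hAle
  push_cast at hAle ⊢
  rw [show (2 * (k : ℝ) + 1 + 1) = 2 * k + 2 by ring, div_mul_eq_mul_div, div_mul_eq_mul_div,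
    div_le_iff₀ (by positivity), add_mul, div_mul_cancel₀ _ (by positivity)]
  linarith

lemma null_of_lines {d : ℕ} (S : Set (EuclideanSpace ℝ (Fin d))) (hS : MeasurableSet S)
    (v : EuclideanSpace ℝ (Fin d)) (h : ∀ y, volume {t : ℝ | y + t • v ∈ S} = 0) :
    volume S = 0 := by
  have hm : Measurable (Function.uncurry fun (t : ℝ) (y : EuclideanSpace ℝ (Fin d)) =>
      S.indicator (fun _ => (1 : ENNReal)) (y + t • v)) := by
    have h1 : Measurable (S.indicator (fun _ => (1 : ENNReal))) := measurable_const.indicator hS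
    exact h1.comp (by fun_prop : Measurable fun q : ℝ × EuclideanSpace ℝ (Fin d) => q.2 + q.1 • v)
  have hsw := lintegral_lintegral_swap (μ := volume.restrict (Set.Icc (0 : ℝ) 1))
    (ν := (volume : Measure (EuclideanSpace ℝ (Fin d)))) hm.aemeasurable
  have hl : ∀ t : ℝ, ∫⁻ y, S.indicator (fun _ => (1 : ENNReal)) (y + t • v) = volume S := by
    intro t
    rw [lintegral_add_right_eq_self (fun y => S.indicator (fun _ => (1 : ENNReal)) y) (t • v)]
    rw [lintegral_indicator hS]; simp
  have hr : ∀ y, ∫⁻ t in Set.Icc (0 : ℝ) 1,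
      S.indicator (fun _ => (1 : ENNReal)) (y + t • v) = 0 := by
    intro y
    have hae : ∀ᵐ t : ℝ, y + t • v ∉ S := by
      rw [ae_iff]; simpa using h y
    rw [lintegral_congr_ae (g := fun _ => 0)]
    · simp
    · filter_upwards [ae_restrict_of_ae hae] with t ht
      simp [ht]
  simp only [hl, hr] at hsw
  simpa using hsw

lemma integrable_mixed {d : ℕ} (P : Measure (EuclideanSpace ℝ (Fin d)))
    (N : ℕ) (hP : Integrable (fun x => ‖x‖ ^ N) P) (v y : EuclideanSpace ℝ (Fin d)) (m : ℕ)
    (hm : m ≤ N) : Integrable (fun z => ⟪v, z⟫ ^ m * ⟪y, z⟫ ^ (N - m)) P := by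
  refine (hP.const_mul (‖v‖ ^ m * ‖y‖ ^ (N - m))).mono' ?_ (Filter.Eventually.of_forall fun z => ?_)
  · exact Continuous.aestronglyMeasurable (by fun_prop)
  · rw [norm_mul, norm_pow, norm_pow]
    calc _ ≤ (‖v‖ * ‖z‖) ^ m * (‖y‖ * ‖z‖) ^ (N - m) := by
          gcongr <;> exact norm_inner_le_norm _ _
      _ = ‖v‖ ^ m * ‖y‖ ^ (N - m) * (‖z‖ ^ m * ‖z‖ ^ (N - m)) := by ring
      _ = _ := by rw [← pow_add, Nat.add_sub_cancel' hm]

lemma moments_eq {d : ℕ} (P Q : Measure (EuclideanSpace ℝ (Fin d)))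
    (N : ℕ) (hP : Integrable (fun x => ‖x‖ ^ N) P) (hQ : Integrable (fun x => ‖x‖ ^ N) Q)
    (S : Set (EuclideanSpace ℝ (Fin d))) (hS : MeasurableSet S) (hpos : 0 < volume S)
    (hSe : ∀ x ∈ S, ∫ z, ⟪x, z⟫ ^ N ∂P = ∫ z, ⟪x, z⟫ ^ N ∂Q) (v : EuclideanSpace ℝ (Fin d)) :
    ∫ z, ⟪v, z⟫ ^ N ∂P = ∫ z, ⟪v, z⟫ ^ N ∂Q := by
  by_contra hne
  refine hpos.ne' (null_of_lines S hS v fun y => ?_)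
  set a : ℕ → ℝ := fun m => ((∫ z, ⟪v, z⟫ ^ m * ⟪y, z⟫ ^ (N - m) ∂P)
    - ∫ z, ⟪v, z⟫ ^ m * ⟪y, z⟫ ^ (N - m) ∂Q) * (N.choose m) with ha
  set g : Polynomial ℝ := ∑ m ∈ Finset.range (N + 1), Polynomial.C (a m) * Polynomial.X ^ m with hg
  have hg0 : g ≠ 0 := by
    intro h0
    have h1 : g.coeff N = a N := by
      simp [hg, Polynomial.coeff_X_pow]
    rw [h0] at h1
    simp [ha] at h1
    exact hne (sub_eq_zero.1 h1.symm)
  have hexp : ∀ (μ : Measure (EuclideanSpace ℝ (Fin d))), Integrable (fun x => ‖x‖ ^ N) μ →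
      ∀ t : ℝ, ∫ z, ⟪y + t • v, z⟫ ^ N ∂μ = ∑ m ∈ Finset.range (N + 1),
        t ^ m * (∫ z, ⟪v, z⟫ ^ m * ⟪y, z⟫ ^ (N - m) ∂μ) * (N.choose m) := by
    intro μ hμ t
    have e : ∀ z : EuclideanSpace ℝ (Fin d), ⟪y + t • v, z⟫ ^ N = ∑ m ∈ Finset.range (N + 1),
        (t ^ m * (N.choose m)) * (⟪v, z⟫ ^ m * ⟪y, z⟫ ^ (N - m)) := by
      intro z
      rw [inner_add_left, real_inner_smul_left, add_comm, add_pow]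
      refine Finset.sum_congr rfl fun m _ => ?_
      ring
    simp_rw [e]
    rw [integral_finsetSum]
    · refine Finset.sum_congr rfl fun m _ => ?_
      rw [integral_const_mul]; ring
    · intro m hm
      exact (integrable_mixed μ N hμ v y m (by simpa [Nat.lt_succ_iff] using hm)).const_mul _
  have heval : ∀ t : ℝ, g.eval t = ∫ z, ⟪y + t • v, z⟫ ^ N ∂P - ∫ z, ⟪y + t • v, z⟫ ^ N ∂Q := by
    intro t
    rw [hexp P hP, hexp Q hQ, ← Finset.sum_sub_distrib, hg, Polynomial.eval_finsetSum]
    refine Finset.sum_congr rfl fun m _ => ?_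
    simp [ha]; ring
  refine Set.Finite.measure_zero ?_ _
  refine (Polynomial.finite_setOfPred_isRoot hg0).subset fun t ht => ?_
  simp only [Set.mem_ofPred_eq, Polynomial.IsRoot] at ht ⊢
  rw [heval, hSe _ ht, sub_self]

lemma charFn_eq_charFun {d : ℕ} (P : Measure (EuclideanSpace ℝ (Fin d)))
    (y : EuclideanSpace ℝ (Fin d)) : charFn P y = charFun P y := by
  rw [charFn, charFun_apply]
  simp_rw [real_inner_comm]

lemma charFn_map {d : ℕ} (P : Measure (EuclideanSpace ℝ (Fin d)))
    (x : EuclideanSpace ℝ (Fin d)) (t : ℝ) :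
    charFun (P.map (fun z => ⟪x, z⟫)) t = charFn P (t • x) := by
  rw [charFun_apply_real, charFn, integral_map (by fun_prop) (by fun_prop)]
  simp_rw [real_inner_smul_left]
  push_cast
  rfl

set_option maxHeartbeats 2000000 in
/-- **Cramér–Wold variant.** Let `P, Q` be Borel probability measures on `ℝ^d`
(`d ≥ 2`). Assume the absolute moments `m_N = ∫ ‖x‖^N dP` are all finite and satisfy the
Carleman condition `∑_{N≥1} m_N^{-1/N} = ∞`. If `E(P,Q)` has positive Lebesgue measure,
then `P = Q`. -/
theorem eq_of_eqCharFn_set_pos_measure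
    {d : ℕ} (hd : 2 ≤ d)
    (P Q : Measure (EuclideanSpace ℝ (Fin d)))
    [IsProbabilityMeasure P] [IsProbabilityMeasure Q]
    (hmom : ∀ N : ℕ, 1 ≤ N → Integrable (fun x => ‖x‖ ^ N) P)
    (hcarleman : ¬ Summable (fun N : ℕ =>
      (∫ x, ‖x‖ ^ (N + 1) ∂P) ^ (-1 / ((N : ℝ) + 1))))
    (hpos : 0 < volume {x : EuclideanSpace ℝ (Fin d) |
      ∀ t : ℝ, charFn P (t • x) = charFn Q (t • x)}) :
    P = Q := by
  have hmom' : ∀ N : ℕ, Integrable (fun x => ‖x‖ ^ N) P := by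
    intro N
    rcases Nat.eq_zero_or_pos N with rfl | h
    · simp
    · exact hmom N h
  set S := {x : EuclideanSpace ℝ (Fin d) |
      ∀ t : ℝ, charFn P (t • x) = charFn Q (t • x)} with hSdef
  have hSm : MeasurableSet S := by
    apply IsClosed.measurableSet
    simp only [hSdef, charFn_eq_charFun, Set.ofPred_forall]
    refine isClosed_iInter fun t => isClosed_eq ?_ ?_
    · exact continuous_charFun.comp (continuous_const_smul t)
    · exact continuous_charFun.comp (continuous_const_smul t)
  have hinner : ∀ x : EuclideanSpace ℝ (Fin d),
      Measurable (fun z : EuclideanSpace ℝ (Fin d) => ⟪x, z⟫) := fun x => by fun_prop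
  have prob : ∀ (R : Measure (EuclideanSpace ℝ (Fin d))) [IsProbabilityMeasure R]
      (x : EuclideanSpace ℝ (Fin d)), IsProbabilityMeasure (R.map (fun z => ⟪x, z⟫)) :=
    fun R _ x => Measure.isProbabilityMeasure_map (hinner x).aemeasurable
  have hSmap : ∀ x ∈ S, P.map (fun z => ⟪x, z⟫) = Q.map (fun z => ⟪x, z⟫) := by
    intro x hx
    have := prob P x
    have := prob Q x
    apply Measure.ext_of_charFun
    funext t
    rw [charFn_map, charFn_map]
    exact hx t
  have memid : ∀ (R : Measure (EuclideanSpace ℝ (Fin d))), IsProbabilityMeasure R →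
      (∀ N : ℕ, Integrable (fun x => ‖x‖ ^ N) R) → ∀ N : ℕ, MemLp (fun z => z) N R := by
    intro R _ hR N
    rcases Nat.eq_zero_or_pos N with rfl | h
    · simp; fun_prop
    · rw [← integrable_norm_rpow_iff (by fun_prop) (by simpa using h.ne') (by simp)]
      simpa using hR N
  have meminner : ∀ (R : Measure (EuclideanSpace ℝ (Fin d))), IsProbabilityMeasure R →
      (∀ N : ℕ, Integrable (fun x => ‖x‖ ^ N) R) → ∀ (N : ℕ) x,
      MemLp (fun z => ⟪x, z⟫) N R := by
    intro R _ hR N x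
    exact (memid R inferInstance hR N).const_inner x
  have memmap : ∀ (R : Measure (EuclideanSpace ℝ (Fin d))) (N : ℕ) x,
      MemLp (fun z => ⟪x, z⟫) N R ↔ MemLp id N (R.map (fun z => ⟪x, z⟫)) := by
    intro R N x
    rw [memLp_map_measure_iff (by fun_prop) (hinner x).aemeasurable]
    rfl
  -- moments of Q
  have hQinner : ∀ (N : ℕ) x, MemLp (fun z => ⟪x, z⟫) N Q := by
    intro N
    let W : Submodule ℝ (EuclideanSpace ℝ (Fin d)) :=
      { carrier := {x | MemLp (fun z => ⟪x, z⟫) N Q}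
        add_mem' := by
          intro a b ha hb
          simp only [Set.mem_ofPred_eq, inner_add_left] at *
          exact ha.add hb
        zero_mem' := by simp
        smul_mem' := by
          intro c a ha
          simp only [Set.mem_ofPred_eq, real_inner_smul_left] at *
          exact ha.const_mul c }
    have hSW : S ⊆ W := by
      intro x hx
      change MemLp (fun z => ⟪x, z⟫) N Q
      rw [memmap, ← hSmap x hx, ← memmap]
      exact meminner P inferInstance hmom' N x
    have hW : W = ⊤ := by
      by_contra hne
      exact hpos.ne' (measure_mono_null hSW (Measure.addHaar_submodule volume W hne))
    intro x
    have : x ∈ W := hW ▸ Submodule.mem_top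
    exact this
  have hQmom : ∀ N : ℕ, Integrable (fun x => ‖x‖ ^ N) Q := by
    intro N
    have : MemLp (fun z : EuclideanSpace ℝ (Fin d) => z) N Q := by
      have e : (fun z : EuclideanSpace ℝ (Fin d) => z) =
          fun z => ∑ i, ⟪EuclideanSpace.basisFun (Fin d) ℝ i, z⟫ •
            EuclideanSpace.basisFun (Fin d) ℝ i := by
        funext z
        exact ((EuclideanSpace.basisFun (Fin d) ℝ).sum_repr' z).symm
      rw [e]
      refine memLp_finsetSum _ fun i _ => ?_
      exact ((ContinuousLinearMap.id ℝ ℝ).smulRight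
        (EuclideanSpace.basisFun (Fin d) ℝ i)).comp_memLp' (hQinner N _)
    exact this.integrable_norm_pow'
  have hmomeq : ∀ (N : ℕ) v, ∫ z, ⟪v, z⟫ ^ N ∂P = ∫ z, ⟪v, z⟫ ^ N ∂Q := by
    intro N
    refine moments_eq P Q N (hmom' N) (hQmom N) S hSm hpos fun x hx => ?_
    have h1 : ∀ μ : Measure (EuclideanSpace ℝ (Fin d)),
        ∫ z, ⟪x, z⟫ ^ N ∂μ = ∫ y, y ^ N ∂(μ.map (fun z => ⟪x, z⟫)) := fun μ => by
      rw [integral_map (hinner x).aemeasurable (by fun_prop)]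
    rw [h1, h1, hSmap x hx]
  -- the Carleman condition along even indices
  set m : ℕ → ℝ := fun N => ∫ x, ‖x‖ ^ N ∂P with hm
  have hm0 : ∀ N, 0 ≤ m N := fun N => integral_nonneg fun x => by positivity
  have hmpos : ∀ N, 0 < m N := by
    intro N
    refine lt_of_le_of_ne (hm0 N) fun h => hcarleman ?_
    have hz := (integral_eq_zero_iff_of_nonneg (fun y => pow_nonneg (norm_nonneg y) N)
      (hmom' N)).1 h.symm
    have : ∀ k : ℕ, m (k + 1) = 0 := by
      intro k
      simp only [hm]
      rw [integral_congr_ae (g := fun _ => 0)]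
      · simp
      · filter_upwards [hz] with y hy
        have : ‖y‖ = 0 := eq_zero_of_pow_eq_zero hy
        simp [this]
    convert summable_zero (β := ℕ) (α := ℝ) using 2 with k
    change (m (k + 1)) ^ _ = _
    rw [this, Real.zero_rpow]
    · exact div_ne_zero (by norm_num) (by positivity)
  have hlc := moment_logconvex P (fun x => ‖x‖) (fun x => norm_nonneg x) hmom'
  have hm1 : m 0 = 1 := by simp [hm]
  have hlyap : ∀ n : ℕ, m n ^ (n + 1) ≤ m (n + 1) ^ n := by
    intro n
    induction n with
    | zero => simp [hm1]
    | succ n ih =>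
      have h1 : m (n + 1) ^ 2 ≤ m n * m (n + 2) := hlc n
      have h2 : m (n + 1) ^ n * m (n + 1) ^ (n + 2) ≤ m (n + 1) ^ n * m (n + 2) ^ (n + 1) := by
        calc m (n + 1) ^ n * m (n + 1) ^ (n + 2) = (m (n + 1) ^ 2) ^ (n + 1) := by ring
          _ ≤ (m n * m (n + 2)) ^ (n + 1) := by gcongr
          _ = m n ^ (n + 1) * m (n + 2) ^ (n + 1) := by ring
          _ ≤ _ := by gcongr
      exact le_of_mul_le_mul_left h2 (pow_pos (hmpos _) _)
  set c : ℕ → ℝ := fun N => (m (N + 1)) ^ (-1 / ((N : ℝ) + 1)) with hc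
  have hcanti : ∀ N, c (N + 1) ≤ c N := by
    intro N
    simp only [hc]
    have h1 := hlyap (N + 1)
    have p1 := hmpos (N + 1)
    have p2 := hmpos (N + 1 + 1)
    rw [← Real.log_le_log_iff (by positivity) (by positivity), Real.log_rpow p1, Real.log_rpow p2]
    rw [← Real.log_le_log_iff (by positivity) (by positivity), Real.log_pow, Real.log_pow] at h1
    push_cast at h1 ⊢
    rw [div_mul_eq_mul_div, div_mul_eq_mul_div, div_le_div_iff₀ (by positivity) (by positivity)]
    linarith
  have hceven : ¬ Summable (fun k : ℕ => c (2 * k + 1)) := by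
    intro hs
    apply hcarleman
    change Summable c
    have hc0 : ∀ n, 0 ≤ c n := fun n => Real.rpow_nonneg (hm0 _) _
    have hs2 : Summable (fun k : ℕ => c (2 * k)) := by
      rw [← summable_nat_add_iff 1]
      refine Summable.of_nonneg_of_le (fun k => hc0 _) (fun k => ?_) hs
      exact hcanti (2 * k + 1)
    exact (hs2.hasSum.even_add_odd hs.hasSum).summable
  apply Measure.ext_of_charFun
  funext x
  have := prob P x
  have := prob Q x
  have hfin := carleman_1d (P.map (fun z => ⟪x, z⟫)) (Q.map (fun z => ⟪x, z⟫))
    (fun n => (memmap P n x).1 (meminner P inferInstance hmom' n x))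
    (fun n => (memmap Q n x).1 (hQinner n x))
    (fun n => by
      rw [integral_map (hinner x).aemeasurable (by fun_prop),
        integral_map (hinner x).aemeasurable (by fun_prop)]
      exact hmomeq n x)
    (fun hne hs => hceven (by
      rw [integral_map (hinner x).aemeasurable (by fun_prop)] at hne
      refine Summable.of_nonneg_of_le (fun k => Real.rpow_nonneg (hm0 _) _) (fun k => ?_)
        (hs.mul_left ‖x‖)
      rw [integral_map (hinner x).aemeasurable (by fun_prop)]
      set A := ∫ z, |⟪x, z⟫| ^ (2 * k + 2) ∂P with hA
      have iA : Integrable (fun z => |⟪x, z⟫| ^ (2 * k + 2)) P := by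
        simpa using (meminner P inferInstance hmom' (2 * k + 2) x).integrable_norm_pow'
      have hA0 : 0 < A := by
        refine lt_of_le_of_ne (integral_nonneg fun z => by positivity) fun h => hne ?_
        have hz := (integral_eq_zero_iff_of_nonneg
          (fun z => pow_nonneg (abs_nonneg ⟪x, z⟫) (2 * k + 2)) iA).1 h.symm
        rw [integral_congr_ae (g := fun _ => 0)]
        · simp
        · filter_upwards [hz] with z hy
          have : |⟪x, z⟫| = 0 := eq_zero_of_pow_eq_zero hy
          simp [abs_eq_zero.1 this]
      have hAle : A ≤ ‖x‖ ^ (2 * k + 2) * m (2 * k + 2) := by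
        rw [hA, hm, ← integral_const_mul]
        refine integral_mono iA ((hmom' _).const_mul _) fun z => ?_
        simp only
        rw [← mul_pow]
        gcongr
        exact abs_real_inner_le_norm x z
      have hx : 0 < ‖x‖ := by
        rcases (norm_nonneg x).eq_or_lt with h | h
        · rw [← h] at hAle; simp at hAle; linarith
        · exact h
      exact final_ineq A (m (2 * k + 2)) ‖x‖ k hA0 (hmpos _) hx hAle))
  rw [charFn_map, charFn_map, one_smul, charFn_eq_charFun, charFn_eq_charFun] at hfin
  exact hfin
end

section
/- Let d ≥ 2 and let T : ℝ^d → ℝ^d be a linear map such that T ≠ I but T^n = I for some n ≥ 2. Let (M_N)_{N≥0} be a sequence of positive reals satisfying M_0 = 1, M_N² ≤ M_{N−1}M_{N+1} for all N ≥ 1, and ∑_{N≥1} M_N^{-1/N} < ∞. Then there exists a Borel probability measure P on ℝ^d such that: (i) ∫ ‖x‖^N dP(x) ≤ M_N for all N ≥ 0; (ii) the set E(P, PT⁻¹) has positive Lebesgue measure in ℝ^d; and (iii) PT⁻¹ ≠ P. -/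
open MeasureTheory
open scoped RealInnerProductSpace ENNReal

/-- The set `E(P,Q) = {x ∈ ℝ^d : φ_P(tx) = φ_Q(tx) for all t ∈ ℝ}`. -/
def eqCharFnSet {d : ℕ} (P Q : Measure (EuclideanSpace ℝ (Fin d))) :
    Set (EuclideanSpace ℝ (Fin d)) :=
  {x | ∀ t : ℝ, charFn P (t • x) = charFn Q (t • x)}

section FT
variable {V : Type*} [NormedAddCommGroup V] [InnerProductSpace ℝ V] [FiniteDimensional ℝ V]
  [MeasurableSpace V] [BorelSpace V]

/-- Fourier transform of a density, characteristic-function normalization. -/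
noncomputable def ftc (h : V → ℂ) (y : V) : ℂ :=
  ∫ z, Complex.exp ((⟪y, z⟫ : ℝ) * Complex.I) * h z

theorem sinc_repr (u : ℝ) :
    (Real.sinc u : ℂ) = (1/2) * ∫ s in (-1:ℝ)..1, Complex.exp ((s * u : ℝ) * Complex.I) := by
  by_cases hu : u = 0
  · subst hu
    simp
    norm_num
  · have h := intervalIntegral.integral_comp_mul_right
      (fun t : ℝ => Complex.exp ((t : ℂ) * Complex.I)) (a := -1) (b := 1) hu
    rw [h]
    have h2 := integral_exp_mul_I_eq_sinc u
    simp only [neg_mul, one_mul]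
    rw [h2]
    have : (u : ℂ) ≠ 0 := by exact_mod_cast hu
    rw [Complex.real_smul]
    push_cast
    field_simp

theorem sinc_sub_one_le (u : ℝ) : |Real.sinc u - 1| ≤ 2 * |u| := by
  rcases le_or_gt 1 |u| with h | h
  · have := abs_le.mp (Real.abs_sinc_le_one u)
    rw [abs_le]; constructor <;> linarith
  · by_cases hu : u = 0
    · simp [hu]
    have hpos : 0 < |u| := abs_pos.mpr hu
    have h1 := Real.sin_gt_sub_cube hpos
    have h2 : Real.sinc u = Real.sinc |u| := by
      rcases abs_choice u with h | h <;> rw [h]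
      rw [Real.sinc_neg]
    have h3 : 1 - |u|^2/4 ≤ Real.sinc |u| := by
      rw [Real.sinc_of_ne_zero hpos.ne', le_div_iff₀ hpos]
      nlinarith
    have h4 := Real.sinc_le_one u
    rw [abs_le]; constructor <;> nlinarith

theorem ftc_integrable {h : V → ℂ} (hh : Integrable h) (y : V) :
    Integrable (fun z => Complex.exp ((⟪y, z⟫ : ℝ) * Complex.I) * h z) := by
  refine hh.bdd_mul (c := 1) ?_ ?_
  · exact Continuous.aestronglyMeasurable (by fun_prop)
  · exact Filter.Eventually.of_forall fun z => by rw [Complex.norm_exp_ofReal_mul_I]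

theorem ftc_sinc {h : V → ℂ} (hh : Integrable h) {R : ℝ}
    (hR : ∀ y, R < ‖y‖ → ftc h y = 0) (e : V) (y : V) (hy : R + ‖e‖ < ‖y‖) :
    ftc (fun z => (Real.sinc ⟪e, z⟫ : ℂ) * h z) y = 0 := by
  have key : ∀ z, Complex.exp ((⟪y, z⟫ : ℝ) * Complex.I) * ((Real.sinc ⟪e, z⟫ : ℂ) * h z)
      = (1/2) * ∫ s in Set.Ioc (-1:ℝ) 1,
        Complex.exp ((⟪y + s • e, z⟫ : ℝ) * Complex.I) * h z := by
    intro z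
    rw [sinc_repr, intervalIntegral.integral_of_le (by norm_num)]
    have : ∀ s : ℝ, Complex.exp ((⟪y + s • e, z⟫ : ℝ) * Complex.I) * h z =
      (Complex.exp ((⟪y, z⟫ : ℝ) * Complex.I) * h z) *
        Complex.exp ((s * ⟪e, z⟫ : ℝ) * Complex.I) := by
      intro s
      rw [inner_add_left, inner_smul_left]
      push_cast
      rw [add_mul, Complex.exp_add]
      simp
      ring
    simp_rw [this]
    rw [integral_const_mul]
    ring
  unfold ftc
  simp_rw [key]
  rw [integral_const_mul, integral_integral_swap]
  · have : ∀ s ∈ Set.Ioc (-1:ℝ) 1,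
        (∫ z, Complex.exp ((⟪y + s • e, z⟫ : ℝ) * Complex.I) * h z) = 0 := by
      intro s hs
      apply hR
      have h1 : ‖s • e‖ ≤ ‖e‖ := by
        rw [norm_smul, Real.norm_eq_abs]
        have : |s| ≤ 1 := abs_le.mpr ⟨hs.1.le, hs.2⟩
        nlinarith [norm_nonneg e]
      have h2 := norm_sub_le (y + s • e) (s • e)
      rw [add_sub_cancel_right] at h2
      linarith
    rw [setIntegral_congr_fun measurableSet_Ioc this]
    simp
  · have h1 : Integrable (fun p : V × ℝ => h p.1)
        (volume.prod (volume.restrict (Set.Ioc (-1:ℝ) 1))) := hh.comp_fst _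
    refine Integrable.bdd_mul (c := 1) h1 ?_ ?_
    · exact Continuous.aestronglyMeasurable (by fun_prop)
    · exact Filter.Eventually.of_forall fun z => by rw [Complex.norm_exp_ofReal_mul_I]

theorem prod_sinc_abs_le {ι : Type*} (e : ι → V) (s : Finset ι) (z : V) :
    |∏ j ∈ s, Real.sinc ⟪e j, z⟫| ≤ 1 := by
  rw [Finset.abs_prod]
  exact Finset.prod_le_one (fun _ _ => abs_nonneg _) (fun _ _ => Real.abs_sinc_le_one _)

theorem prod_sinc_integrable {ι : Type*} (e : ι → V) (s : Finset ι) {h : V → ℂ}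
    (hh : Integrable h) :
    Integrable (fun z => ((∏ j ∈ s, Real.sinc ⟪e j, z⟫ : ℝ) : ℂ) * h z) := by
  refine hh.bdd_mul (c := 1) ?_ ?_
  · refine Continuous.aestronglyMeasurable ?_
    refine Complex.continuous_ofReal.comp (continuous_finsetProd _ fun j _ => ?_)
    exact Real.continuous_sinc.comp (by fun_prop)
  · exact Filter.Eventually.of_forall fun z => by
      rw [Complex.norm_real]; exact prod_sinc_abs_le e s z

theorem ftc_prod_sinc {ι : Type*} (e : ι → V) (s : Finset ι) {h : V → ℂ}
    (hh : Integrable h) {R : ℝ}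
    (hR : ∀ y, R < ‖y‖ → ftc h y = 0) (y : V) (hy : R + ∑ j ∈ s, ‖e j‖ < ‖y‖) :
    ftc (fun z => ((∏ j ∈ s, Real.sinc ⟪e j, z⟫ : ℝ) : ℂ) * h z) y = 0 := by
  classical
  induction s using Finset.induction_on generalizing y with
  | empty => simpa using hR y (by simpa using hy)
  | insert a s ha ih =>
    rw [Finset.sum_insert ha] at hy
    have := ftc_sinc (prod_sinc_integrable e s hh) (R := R + ∑ j ∈ s, ‖e j‖)
      (fun y hy => ih y hy) (e a) y (by linarith)
    rw [← this]
    congr 1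
    ext z
    rw [Finset.prod_insert ha]
    push_cast
    ring

theorem abs_prod_sub_one_le {ι : Type*} (s : Finset ι) (f : ι → ℝ) (hf : ∀ j, |f j| ≤ 1) :
    |∏ j ∈ s, f j - 1| ≤ ∑ j ∈ s, |f j - 1| := by
  classical
  induction s using Finset.induction_on with
  | empty => simp
  | insert a s ha ih =>
    rw [Finset.prod_insert ha, Finset.sum_insert ha]
    have : f a * ∏ j ∈ s, f j - 1 = f a * (∏ j ∈ s, f j - 1) + (f a - 1) := by ring
    rw [this]
    refine (abs_add_le _ _).trans ?_
    rw [abs_mul]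
    have h1 := hf a
    nlinarith [abs_nonneg (∏ j ∈ s, f j - 1)]

/-- Infinite product of sincs. -/
noncomputable def sincProd {ι : Type*} (e : ι → V) (z : V) : ℝ := ∏' j, Real.sinc ⟪e j, z⟫

theorem sinc_sub_one_le' (e z : V) : |Real.sinc ⟪e, z⟫ - 1| ≤ 2 * ‖z‖ * ‖e‖ := by
  have h1 := sinc_sub_one_le ⟪e, z⟫
  have h2 := abs_real_inner_le_norm e z
  nlinarith

theorem sincProd_tendsto {ι : Type*} {e : ι → V} (he : Summable fun j => ‖e j‖) (z : V) :
    Filter.Tendsto (fun s : Finset ι => ∏ j ∈ s, Real.sinc ⟪e j, z⟫) Filter.atTop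
      (nhds (sincProd e z)) := by
  have h1 : Summable fun j => ‖Real.sinc ⟪e j, z⟫ - 1‖ :=
    Summable.of_nonneg_of_le (fun _ => norm_nonneg _) (fun j => sinc_sub_one_le' (e j) z)
      (he.mul_left _)
  have h2 := multipliable_one_add_of_summable h1
  simp only [add_sub_cancel] at h2
  exact h2.hasProd

theorem sincProd_sub_one_le {ι : Type*} {e : ι → V} (he : Summable fun j => ‖e j‖) (z : V) :
    |sincProd e z - 1| ≤ 2 * ‖z‖ * ∑' j, ‖e j‖ := by
  have h1 := ((sincProd_tendsto he z).sub_const 1).abs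
  refine le_of_tendsto h1 (Filter.Eventually.of_forall fun s => ?_)
  refine (abs_prod_sub_one_le s _ (fun _ => Real.abs_sinc_le_one _)).trans ?_
  refine (Finset.sum_le_sum fun j _ => sinc_sub_one_le' (e j) z).trans ?_
  rw [← Finset.mul_sum]
  exact mul_le_mul_of_nonneg_left (he.sum_le_tsum s fun _ _ => norm_nonneg _) (by positivity)

theorem sincProd_le_prod {ι : Type*} {e : ι → V} (he : Summable fun j => ‖e j‖) (z : V)
    (t : Finset ι) : |sincProd e z| ≤ ∏ j ∈ t, |Real.sinc ⟪e j, z⟫| := by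
  classical
  refine le_of_tendsto (sincProd_tendsto he z).abs ?_
  filter_upwards [Filter.eventually_ge_atTop t] with s hs
  rw [Finset.abs_prod]
  exact Finset.prod_le_prod_of_subset_of_le_one hs (fun _ _ => abs_nonneg _)
    (fun _ _ _ => Real.abs_sinc_le_one _)

theorem ftc_eq_fourier (h : V → ℂ) (y : V) :
    ftc h y = FourierTransform.fourier h (-(2 * Real.pi)⁻¹ • y) := by
  rw [Real.fourier_eq']
  unfold ftc
  congr 1
  ext z
  rw [inner_smul_right, real_inner_comm, smul_eq_mul]
  congr 3
  have := Real.pi_pos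
  push_cast
  have : (Real.pi : ℂ) ≠ 0 := by exact_mod_cast this.ne'
  field_simp

theorem exists_base : ∃ f : V → ℂ, Continuous f ∧ Integrable f ∧ f 0 ≠ 0 ∧
    ∃ R : ℝ, ∀ y, R < ‖y‖ → ftc f y = 0 := by
  obtain ⟨u, h1, h2, h3, h5, h4⟩ :=
    exists_contDiff_tsupport_subset (n := ⊤) (Metric.ball_mem_nhds (0 : V) one_pos)
  have h1' : tsupport (Complex.ofRealCLM ∘ u) ⊆ Metric.ball 0 1 :=
    (tsupport_comp_subset rfl _).trans h1
  have h2' : HasCompactSupport (Complex.ofRealCLM ∘ u) := h2.comp_left rfl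
  let φ : SchwartzMap V ℂ := h2'.toSchwartzMap (Complex.ofRealCLM.contDiff.comp h3)
  have hφ : ∀ z, φ z = (u z : ℂ) := fun z => rfl
  let f : SchwartzMap V ℂ := FourierTransformInv.fourierInv φ
  refine ⟨f, f.continuous, f.integrable, ?_, 2 * Real.pi, ?_⟩
  · have : f 0 = ((∫ z, u z : ℝ) : ℂ) := by
      change (FourierTransformInv.fourierInv φ : SchwartzMap V ℂ) 0 = _
      rw [SchwartzMap.fourierInv_coe, Real.fourierInv_eq']
      simp [hφ]
      exact integral_ofReal
    rw [this]
    norm_cast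
    refine ne_of_gt ?_
    have hc : Continuous u := h3.continuous
    have hnn : ∀ z, 0 ≤ u z := fun z => (h5 ⟨z, rfl⟩).1
    exact hc.integral_pos_of_hasCompactSupport_nonneg_nonzero h2 hnn (x := 0) (by rw [h4]; simp)
  · intro y hy
    rw [ftc_eq_fourier, ← SchwartzMap.fourier_coe]
    have : FourierTransform.fourier f = φ := FourierTransform.fourier_fourierInv_eq φ
    rw [this]
    refine image_eq_zero_of_notMem_tsupport (fun hmem => ?_)
    have h := h1' hmem
    rw [mem_ball_zero_iff, norm_smul, norm_neg, norm_inv, Real.norm_of_nonneg Real.two_pi_pos.le,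
      inv_mul_lt_iff₀ Real.two_pi_pos] at h
    linarith

theorem exists_ft {ι : Type*} [Countable ι] {e : ι → V} (he : Summable fun j => ‖e j‖) :
    ∃ h k : V → ℂ, Integrable h ∧ Integrable k ∧ (∀ z, h z = (sincProd e z : ℂ) * k z) ∧
    (∃ R : ℝ, ∀ y, R < ‖y‖ → ftc h y = 0) ∧ ∃ y, ftc h y ≠ 0 := by
  obtain ⟨k, hkc, hk, hk0, R, hR⟩ := exists_base (V := V)
  have hlim : ∀ z, Filter.Tendsto (fun s : Finset ι => ((∏ j ∈ s, Real.sinc ⟪e j, z⟫ : ℝ) : ℂ) * k z)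
      Filter.atTop (nhds ((sincProd e z : ℂ) * k z)) := fun z =>
    ((Complex.continuous_ofReal.tendsto _).comp (sincProd_tendsto he z)).mul_const _
  have hmeas : AEStronglyMeasurable (fun z => (sincProd e z : ℂ) * k z) volume :=
    aestronglyMeasurable_of_tendsto_ae Filter.atTop
      (fun s => (prod_sinc_integrable e s hk).aestronglyMeasurable)
      (Filter.Eventually.of_forall hlim)
  have hInteg : Integrable (fun z => (sincProd e z : ℂ) * k z) := by
    refine hk.mono hmeas (Filter.Eventually.of_forall fun z => ?_)
    rw [norm_mul, Complex.norm_real]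
    have := sincProd_le_prod he z ∅
    simp only [Finset.prod_empty] at this
    exact mul_le_of_le_one_left (norm_nonneg _) this
  refine ⟨fun z => (sincProd e z : ℂ) * k z, k, hInteg, hk, fun z => rfl,
    ⟨R + ∑' j, ‖e j‖, ?_⟩, ?_⟩
  · intro y hy
    have ht : Filter.Tendsto (fun s : Finset ι =>
        ftc (fun z => ((∏ j ∈ s, Real.sinc ⟪e j, z⟫ : ℝ) : ℂ) * k z) y) Filter.atTop
        (nhds (ftc (fun z => (sincProd e z : ℂ) * k z) y)) := by
      unfold ftc
      refine tendsto_integral_filter_of_dominated_convergence (fun z => ‖k z‖) ?_ ?_ hk.norm ?_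
      · exact Filter.Eventually.of_forall fun s =>
          (ftc_integrable (prod_sinc_integrable e s hk) y).aestronglyMeasurable
      · refine Filter.Eventually.of_forall fun s => Filter.Eventually.of_forall fun z => ?_
        rw [norm_mul, norm_mul, Complex.norm_exp_ofReal_mul_I, one_mul, Complex.norm_real]
        exact mul_le_of_le_one_left (norm_nonneg _) (prod_sinc_abs_le e s z)
      · exact Filter.Eventually.of_forall fun z => (hlim z).const_mul _
    refine tendsto_nhds_unique ht ?_
    refine tendsto_const_nhds.congr fun s => ?_
    rw [ftc_prod_sinc e s hk hR y]
    have := he.sum_le_tsum s fun _ _ => norm_nonneg _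
    linarith
  · by_contra! hzero
    have h0 : FourierTransform.fourier (fun z => (sincProd e z : ℂ) * k z) = 0 := by
      ext w
      have := hzero (-(2 * Real.pi) • w)
      rw [ftc_eq_fourier, smul_smul] at this
      have h2 : -(2 * Real.pi)⁻¹ * -(2 * Real.pi) = 1 := by
        have := Real.two_pi_pos.ne'
        field_simp
      rw [h2, one_smul] at this
      exact this
    have hone : sincProd e 0 = 1 := by simp [sincProd]
    have hca : ContinuousAt (fun z => (sincProd e z : ℂ) * k z) 0 := by
      refine ContinuousAt.mul ?_ hkc.continuousAt
      refine Complex.continuous_ofReal.continuousAt.comp ?_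
      rw [ContinuousAt, hone, tendsto_iff_norm_sub_tendsto_zero]
      refine squeeze_zero (fun _ => norm_nonneg _) (fun z => sincProd_sub_one_le he z) ?_
      have : Continuous fun z : V => 2 * ‖z‖ * ∑' j, ‖e j‖ := by fun_prop
      simpa using this.tendsto 0
    have := hInteg.fourierInv_fourier_eq (by rw [h0]; exact integrable_zero _ _ _) hca
    rw [h0] at this
    simp [hone] at this
    rw [Real.fourierInv_eq'] at this
    simp at this
    exact hk0 this.symm
end FT

theorem abs_mul_sinc_le (u : ℝ) : |u| * |Real.sinc u| ≤ 1 := by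
  by_cases hu : u = 0
  · simp [hu]
  · rw [Real.sinc_of_ne_zero hu, abs_div, mul_div_cancel₀ _ (abs_pos.mpr hu).ne']
    exact Real.abs_sin_le_one u

theorem summable_ratio (M : ℕ → ℝ) (hMpos : ∀ N, 0 < M N) (hM0 : M 0 = 1)
    (hMlogconvex : ∀ N : ℕ, 1 ≤ N → M N ^ 2 ≤ M (N - 1) * M (N + 1))
    (hMsum : Summable fun N : ℕ => M (N + 1) ^ (-1 / ((N : ℝ) + 1))) :
    Summable fun k : ℕ => M k / M (k + 1) := by
  have hm : ∀ k, 0 < M (k + 1) / M k := fun k => div_pos (hMpos _) (hMpos _)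
  have hmono : ∀ k, M (k + 1) / M k ≤ M (k + 2) / M (k + 1) := by
    intro k
    rw [div_le_div_iff₀ (hMpos _) (hMpos _)]
    have := hMlogconvex (k + 1) (by omega)
    simp only [Nat.add_sub_cancel] at this
    rw [show k + 1 + 1 = k + 2 from rfl] at this
    nlinarith
  have hle : ∀ k, M (k + 1) ≤ (M (k + 1) / M k) ^ (k + 1) := by
    intro k
    induction k with
    | zero => simp [hM0]
    | succ k ih =>
      calc M (k + 1 + 1) = M (k + 1) * (M (k + 1 + 1) / M (k + 1)) := by
            field_simp [(hMpos (k + 1)).ne']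
        _ ≤ (M (k + 1 + 1) / M (k + 1)) ^ (k + 1) * (M (k + 1 + 1) / M (k + 1)) := by
            refine mul_le_mul_of_nonneg_right (ih.trans ?_) (hm (k + 1)).le
            exact pow_le_pow_left₀ (hm k).le (hmono k) _
        _ = _ := by ring
  refine Summable.of_nonneg_of_le (fun k => (div_pos (hMpos _) (hMpos _)).le) (fun k => ?_) hMsum
  have h1 : ((M (k + 1) / M k) ^ (k + 1)) ^ (-1 / ((k : ℝ) + 1)) ≤
      M (k + 1) ^ (-1 / ((k : ℝ) + 1)) := by
    refine Real.rpow_le_rpow_of_nonpos (hMpos _) (hle k) ?_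
    rw [neg_div, neg_nonpos]
    positivity
  refine le_trans (le_of_eq ?_) h1
  rw [← Real.rpow_natCast, ← Real.rpow_mul (hm k).le]
  push_cast
  have : ((k : ℝ) + 1) * (-1 / ((k : ℝ) + 1)) = -1 := by
    have : (k : ℝ) + 1 ≠ 0 := by positivity
    field_simp
  rw [this, Real.rpow_neg_one, inv_div]

theorem exists_coord {d : ℕ} (hd : 1 ≤ d) (z : EuclideanSpace ℝ (Fin d)) :
    ∃ i, ‖z‖ ≤ d * |z i| := by
  have : Nonempty (Fin d) := ⟨⟨0, hd⟩⟩
  obtain ⟨i, hi⟩ := Finite.exists_max (fun i => |z i|)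
  refine ⟨i, ?_⟩
  refine abs_le_of_sq_le_sq' ?_ (by positivity) |>.2
  rw [EuclideanSpace.norm_sq_eq]
  calc ∑ j, ‖z j‖ ^ 2 ≤ ∑ j : Fin d, |z i| ^ 2 :=
        Finset.sum_le_sum fun j _ => pow_le_pow_left₀ (norm_nonneg _) (hi j) 2
    _ = d * |z i| ^ 2 := by simp
    _ ≤ (d * |z i|) ^ 2 := by
        have : (1:ℝ) ≤ d := by exact_mod_cast hd
        rw [mul_pow]
        refine mul_le_mul_of_nonneg_right ?_ (by positivity)
        nlinarith

theorem exists_h {d : ℕ} (hd : 1 ≤ d) (B : ℝ) (hB : 0 < B)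
    (M : ℕ → ℝ) (hMpos : ∀ N, 0 < M N) (hM0 : M 0 = 1)
    (hMlogconvex : ∀ N : ℕ, 1 ≤ N → M N ^ 2 ≤ M (N - 1) * M (N + 1))
    (hMsum : Summable fun N : ℕ => M (N + 1) ^ (-1 / ((N : ℝ) + 1))) :
    ∃ h k : EuclideanSpace ℝ (Fin d) → ℂ, Integrable h ∧ Integrable k ∧
      (∀ N z, (B * ‖z‖) ^ N * ‖h z‖ ≤ M N * ‖k z‖) ∧
      (∃ R : ℝ, ∀ y, R < ‖y‖ → ftc h y = 0) ∧ ∃ y, ftc h y ≠ 0 := by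
  have hs := summable_ratio M hMpos hM0 hMlogconvex hMsum
  have hdpos : (0:ℝ) < d := by exact_mod_cast hd
  set C : ℝ := B * d with hC
  have hCpos : 0 < C := by positivity
  let e : ℕ × Fin d → EuclideanSpace ℝ (Fin d) := fun p =>
    (C * (M p.1 / M (p.1 + 1))) • EuclideanSpace.single p.2 (1 : ℝ)
  have hapos : ∀ k, 0 < M k / M (k + 1) := fun k => div_pos (hMpos _) (hMpos _)
  have he : Summable fun p => ‖e p‖ := by
    have h1 := (hs.mul_left C).mul_of_nonneg (g := fun _ : Fin d => (1:ℝ))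
      (hasSum_fintype _).summable (fun k => (mul_pos hCpos (hapos k)).le) (fun _ => zero_le_one)
    refine h1.congr fun p => ?_
    simp only [e, norm_smul, PiLp.norm_single, norm_one, mul_one]
    rw [Real.norm_of_nonneg (mul_pos hCpos (hapos _)).le]
  obtain ⟨h, k, hh, hk, hhk, hR, hy⟩ := exists_ft he
  refine ⟨h, k, hh, hk, ?_, hR, hy⟩
  intro N z
  obtain ⟨i, hi⟩ := exists_coord hd z
  rw [hhk, norm_mul, ← mul_assoc, Complex.norm_real]
  refine mul_le_mul_of_nonneg_right ?_ (norm_nonneg _)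
  have h1 := sincProd_le_prod he z (Finset.range N ×ˢ {i})
  rw [Finset.prod_product] at h1
  simp only [Finset.prod_singleton] at h1
  calc (B * ‖z‖) ^ N * ‖sincProd e z‖
      ≤ (C * |z i|) ^ N * ∏ k ∈ Finset.range N, |Real.sinc ⟪e (k, i), z⟫| := by
        refine mul_le_mul ?_ h1 (norm_nonneg _) (by positivity)
        refine pow_le_pow_left₀ (by positivity) ?_ _
        rw [hC, mul_assoc]
        exact mul_le_mul_of_nonneg_left hi hB.le
    _ = ∏ k ∈ Finset.range N, (C * |z i|) * |Real.sinc ⟪e (k, i), z⟫| := by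
        rw [Finset.prod_mul_distrib]; simp
    _ ≤ ∏ k ∈ Finset.range N, M (k + 1) / M k := by
        refine Finset.prod_le_prod (fun _ _ => by positivity) fun k _ => ?_
        have h2 : ⟪e (k, i), z⟫ = C * (M k / M (k + 1)) * z i := by
          simp [e, inner_smul_left, EuclideanSpace.inner_single_left]
        have h3 := abs_mul_sinc_le ⟪e (k, i), z⟫
        rw [h2, abs_mul, abs_of_pos (mul_pos hCpos (hapos k))] at h3
        rw [h2]
        have h4 : M (k + 1) / M k = (M k / M (k + 1))⁻¹ := by rw [inv_div]
        rw [h4, ← one_div, le_div_iff₀ (hapos k)]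
        linarith
    _ = M N := by
        clear h1
        induction N with
        | zero => simp [hM0]
        | succ N ih =>
          rw [Finset.prod_range_succ, ih]
          field_simp [(hMpos N).ne']

theorem pow_inner {V : Type*} [NormedAddCommGroup V] [InnerProductSpace ℝ V]
    [FiniteDimensional ℝ V] (T : V →ₗ[ℝ] V) (j : ℕ) (y z : V) :
    ⟪y, (T ^ j) z⟫ = ⟪(LinearMap.adjoint T ^ j) y, z⟫ := by
  induction j generalizing z with
  | zero => simp
  | succ j ih =>
    rw [pow_succ, Module.End.mul_apply, ih, pow_succ', Module.End.mul_apply,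
      LinearMap.adjoint_inner_left]

theorem exp_integrable {d : ℕ} (μ : Measure (EuclideanSpace ℝ (Fin d))) [IsFiniteMeasure μ]
    (y : EuclideanSpace ℝ (Fin d)) :
    Integrable (fun z => Complex.exp ((⟪y, z⟫ : ℝ) * Complex.I)) μ := by
  refine Integrable.of_bound (C := 1) (Continuous.aestronglyMeasurable (by fun_prop)) ?_
  exact Filter.Eventually.of_forall fun z => by rw [Complex.norm_exp_ofReal_mul_I]

theorem charFn_add {d : ℕ} (μ ν : Measure (EuclideanSpace ℝ (Fin d))) [IsFiniteMeasure μ]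
    [IsFiniteMeasure ν] (y : EuclideanSpace ℝ (Fin d)) :
    charFn (μ + ν) y = charFn μ y + charFn ν y :=
  integral_add_measure (exp_integrable μ y) (exp_integrable ν y)

theorem charFn_map_pow {d : ℕ} (μ : Measure (EuclideanSpace ℝ (Fin d)))
    (T : EuclideanSpace ℝ (Fin d) →ₗ[ℝ] EuclideanSpace ℝ (Fin d)) (j : ℕ)
    (y : EuclideanSpace ℝ (Fin d)) :
    charFn (μ.map ⇑(T ^ j)) y = charFn μ ((LinearMap.adjoint T ^ j) y) := by
  unfold charFn
  rw [integral_map]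
  · simp_rw [pow_inner]
  · exact (LinearMap.continuous_of_finiteDimensional (T ^ j)).measurable.aemeasurable
  · exact Continuous.aestronglyMeasurable (by fun_prop)

theorem charFn_withDensity {d : ℕ} {g : EuclideanSpace ℝ (Fin d) → ℝ} (hg : Integrable g)
    (y : EuclideanSpace ℝ (Fin d)) :
    charFn (volume.withDensity fun z => ENNReal.ofReal (g z)) y
      = ftc (fun z => ((max (g z) 0 : ℝ) : ℂ)) y := by
  unfold charFn ftc
  rw [integral_withDensity_eq_integral_toReal_smul₀ hg.aemeasurable.ennreal_ofReal
    (Filter.Eventually.of_forall fun z => ENNReal.ofReal_lt_top)]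
  congr 1
  ext z
  rw [ENNReal.toReal_ofReal', Complex.real_smul, mul_comm]

theorem charFn_pos_sub_neg {d : ℕ} {g : EuclideanSpace ℝ (Fin d) → ℝ} (hg : Integrable g)
    (y : EuclideanSpace ℝ (Fin d)) :
    charFn (volume.withDensity fun z => ENNReal.ofReal (g z)) y
      - charFn (volume.withDensity fun z => ENNReal.ofReal (-g z)) y
      = ftc (fun z => (g z : ℂ)) y := by
  rw [charFn_withDensity hg, charFn_withDensity (g := fun z => -g z) hg.neg]
  unfold ftc
  rw [← integral_sub]
  · congr 1
    ext z
    rw [← mul_sub]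
    congr 1
    rw [← Complex.ofReal_sub]
    congr 1
    rcases le_total (g z) 0 with hz | hz
    · rw [max_eq_right hz, max_eq_left (by linarith)]; ring
    · rw [max_eq_left hz, max_eq_right (by linarith)]; ring
  · exact ftc_integrable (h := fun z => ((max (g z) 0 : ℝ) : ℂ)) hg.pos_part.ofReal y
  · exact ftc_integrable (h := fun z => ((max (-g z) 0 : ℝ) : ℂ)) hg.neg.pos_part.ofReal y

theorem exists_P {d n : ℕ} (hn : 2 ≤ n)
    (T : EuclideanSpace ℝ (Fin d) →ₗ[ℝ] EuclideanSpace ℝ (Fin d))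
    (hTn : T ^ n = LinearMap.id) (B : ℝ) (hB : ∀ j < n, ∀ z, ‖(T ^ j) z‖ ≤ B * ‖z‖)
    (M : ℕ → ℝ) (hMpos : ∀ N, 0 < M N) (hM0 : M 0 = 1)
    (g k : EuclideanSpace ℝ (Fin d) → ℝ) (hg : Integrable g) (hk : Integrable k)
    (hk1 : ∫ z, k z ≤ (n : ℝ)⁻¹) (hk0 : ∀ z, 0 ≤ k z)
    (hgk : ∀ N z, (B * ‖z‖) ^ N * |g z| ≤ M N * k z) :
    ∃ P : Measure (EuclideanSpace ℝ (Fin d)), IsProbabilityMeasure P ∧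
      (∀ N : ℕ, ∫⁻ x, (‖x‖₊ : ℝ≥0∞) ^ N ∂P ≤ ENNReal.ofReal (M N)) ∧
      ∀ y, charFn P y - charFn (P.map ⇑T) y
        = ftc (fun z => (g z : ℂ)) y - ftc (fun z => (g z : ℂ)) (LinearMap.adjoint T y) := by
  have hmeas : ∀ j, Measurable ⇑(T ^ j) := fun j =>
    (LinearMap.continuous_of_finiteDimensional (T ^ j)).measurable
  set νp := volume.withDensity (fun z => ENNReal.ofReal (g z)) with hνp
  set νm := volume.withDensity (fun z => ENNReal.ofReal (-g z)) with hνm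
  have : IsFiniteMeasure νp := isFiniteMeasure_withDensity_ofReal hg.2
  have : IsFiniteMeasure νm := isFiniteMeasure_withDensity_ofReal hg.neg.2
  have hnpos : (0:ℝ) < n := by positivity
  -- moment bound for each piece
  have hbd : ∀ (g' : EuclideanSpace ℝ (Fin d) → ℝ), Integrable g' → (∀ z, |g' z| = |g z|) →
      ∀ j < n, ∀ N : ℕ, ∫⁻ z, (‖(T ^ j) z‖₊ : ℝ≥0∞) ^ N
        ∂(volume.withDensity fun z => ENNReal.ofReal (g' z)) ≤ ENNReal.ofReal (M N * (n : ℝ)⁻¹) := by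
    intro g' hg' habs j hj N
    rw [lintegral_withDensity_eq_lintegral_mul₀ hg'.aemeasurable.ennreal_ofReal
      ((hmeas j).nnnorm.coe_nnreal_ennreal.pow_const N).aemeasurable]
    calc _ ≤ ∫⁻ z, ENNReal.ofReal (M N * k z) := by
          refine lintegral_mono fun z => ?_
          simp only [Pi.mul_apply]
          rw [← ENNReal.ofReal_coe_nnreal, coe_nnnorm, ← ENNReal.ofReal_pow (norm_nonneg _),
            ← ENNReal.ofReal_mul' (by positivity)]
          refine ENNReal.ofReal_le_ofReal (le_trans ?_ (hgk N z))
          rw [mul_comm, ← habs]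
          exact (mul_le_mul_of_nonneg_left (le_abs_self _) (by positivity)).trans
            (mul_le_mul_of_nonneg_right (pow_le_pow_left₀ (norm_nonneg _) (hB j hj z) N)
              (abs_nonneg _))
      _ = ENNReal.ofReal (∫ z, M N * k z) :=
          (ofReal_integral_eq_lintegral_ofReal (hk.const_mul _)
            (Filter.Eventually.of_forall fun z => mul_nonneg (hMpos N).le (hk0 z))).symm
      _ ≤ _ := by
          rw [integral_const_mul]
          exact ENNReal.ofReal_le_ofReal (mul_le_mul_of_nonneg_left hk1 (hMpos N).le)
  let μ := νp + ∑ j ∈ Finset.range (n - 1), νm.map ⇑(T ^ (j + 1))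
  have hμmom : ∀ N : ℕ, ∫⁻ x, (‖x‖₊ : ℝ≥0∞) ^ N ∂μ ≤ ENNReal.ofReal (M N) := by
    intro N
    simp only [μ]
    rw [lintegral_add_measure, lintegral_finsetSum_measure]
    have h1 := hbd g hg (fun _ => rfl) 0 (by omega) N
    simp only [pow_zero, Module.End.one_apply] at h1
    have h2 : ∀ j ∈ Finset.range (n - 1), ∫⁻ x, (‖x‖₊ : ℝ≥0∞) ^ N ∂(νm.map ⇑(T ^ (j + 1)))
        ≤ ENNReal.ofReal (M N * (n : ℝ)⁻¹) := by
      intro j hj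
      rw [Finset.mem_range] at hj
      rw [lintegral_map (by fun_prop) (hmeas _)]
      exact hbd (fun z => -g z) hg.neg (fun z => abs_neg _) (j + 1) (by omega) N
    calc _ ≤ ENNReal.ofReal (M N * (n : ℝ)⁻¹)
          + ∑ j ∈ Finset.range (n - 1), ENNReal.ofReal (M N * (n : ℝ)⁻¹) :=
          add_le_add h1 (Finset.sum_le_sum h2)
      _ = n * ENNReal.ofReal (M N * (n : ℝ)⁻¹) := by
          rw [Finset.sum_const, Finset.card_range, nsmul_eq_mul]
          obtain ⟨m, rfl⟩ : ∃ m, n = m + 1 := ⟨n - 1, by omega⟩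
          simp only [Nat.add_sub_cancel]
          push_cast
          ring
      _ = ENNReal.ofReal (M N) := by
          rw [← ENNReal.ofReal_natCast, ← ENNReal.ofReal_mul hnpos.le]
          congr 1
          field_simp
  have hμ1 : μ Set.univ ≤ 1 := by
    have := hμmom 0
    simpa [hM0] using this
  have hμfin : IsFiniteMeasure μ := ⟨hμ1.trans_lt ENNReal.one_lt_top⟩
  let c : ℝ≥0∞ := 1 - μ Set.univ
  have hcfin : c ≠ ∞ := (tsub_le_self.trans_lt ENNReal.one_lt_top).ne
  let δ : Measure (EuclideanSpace ℝ (Fin d)) := c • Measure.dirac 0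
  have hδfin : IsFiniteMeasure δ := ⟨by
    simp only [δ, Measure.smul_apply, measure_univ, smul_eq_mul, mul_one]
    exact hcfin.lt_top⟩
  have hδmap : δ.map ⇑T = δ := by
    have := hmeas 1
    rw [pow_one] at this
    simp only [δ]
    rw [Measure.map_smul, Measure.map_dirac' this, map_zero]
  have hδ : ∀ y, charFn δ (LinearMap.adjoint T y) = charFn δ y := by
    intro y
    have := charFn_map_pow δ T 1 y
    rw [pow_one, pow_one, hδmap] at this
    exact this.symm
  refine ⟨δ + μ, ⟨?_⟩, ?_, ?_⟩
  · simp only [δ, Measure.add_apply, Measure.smul_apply, measure_univ, smul_eq_mul, mul_one, c]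
    exact tsub_add_cancel_of_le hμ1
  · intro N
    rcases Nat.eq_zero_or_pos N with rfl | hN
    · simp only [pow_zero, lintegral_one, hM0, ENNReal.ofReal_one]
      simp only [δ, Measure.add_apply, Measure.smul_apply, measure_univ, smul_eq_mul, mul_one, c]
      exact (tsub_add_cancel_of_le hμ1).le
    · rw [lintegral_add_measure]
      simp only [δ]
      rw [lintegral_smul_measure, lintegral_dirac' _ (by fun_prop)]
      simp only [nnnorm_zero, ENNReal.coe_zero, zero_pow hN.ne', smul_zero, zero_add]
      exact hμmom N
  · intro y
    have hsum : ∀ (s : Finset ℕ) y, charFn (∑ j ∈ s, νm.map ⇑(T ^ (j + 1))) y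
        = ∑ j ∈ s, charFn νm ((LinearMap.adjoint T ^ (j + 1)) y) := by
      intro s y
      simp_rw [← charFn_map_pow]
      exact integral_finsetSum_measure fun j _ => exp_integrable _ y
    have hP : ∀ y, charFn (δ + μ) y = charFn δ y + (charFn νp y +
        ∑ j ∈ Finset.range (n - 1), charFn νm ((LinearMap.adjoint T ^ (j + 1)) y)) := by
      intro y
      rw [charFn_add, charFn_add, hsum]
    have h1 := charFn_map_pow (δ + μ) T 1 y
    rw [pow_one, pow_one] at h1
    rw [h1, hP, hP, hδ, ← charFn_pos_sub_neg hg, ← charFn_pos_sub_neg hg]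
    have hpow : ∀ j, (LinearMap.adjoint T ^ (j + 1)) (LinearMap.adjoint T y)
        = (LinearMap.adjoint T ^ (j + 1 + 1)) y := by
      intro j
      rw [pow_succ _ (j + 1), Module.End.mul_apply]
    simp_rw [hpow]
    have hadj : (LinearMap.adjoint T ^ n) y = y := by
      refine ext_inner_right ℝ fun z => ?_
      rw [← pow_inner, hTn, LinearMap.id_apply]
    have htel := Finset.sum_range_sub'
      (fun j => charFn νm ((LinearMap.adjoint T ^ (j + 1)) y)) (n - 1)
    rw [Finset.sum_sub_distrib] at htel
    rw [show n - 1 + 1 = n by omega, hadj, zero_add, pow_one] at htel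
    linear_combination htel

theorem gram_pos {V : Type*} [NormedAddCommGroup V] [InnerProductSpace ℝ V] {v x : V}
    (hv : v ≠ 0) (hx : x ∉ Submodule.span ℝ {v}) : 0 < ‖x‖ ^ 2 * ‖v‖ ^ 2 - ⟪x, v⟫ ^ 2 := by
  have hv2 : 0 < ‖v‖ ^ 2 := by have := norm_pos_iff.mpr hv; positivity
  have h1 : x - (⟪x, v⟫ / ‖v‖ ^ 2) • v ≠ 0 := by
    intro h
    exact hx (Submodule.mem_span_singleton.mpr ⟨_, (sub_eq_zero.mp h).symm⟩)
  have h2 : 0 < ‖x - (⟪x, v⟫ / ‖v‖ ^ 2) • v‖ ^ 2 := by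
    have := norm_pos_iff.mpr h1; positivity
  rw [norm_sub_sq_real, inner_smul_right, norm_smul, mul_pow, Real.norm_eq_abs, sq_abs] at h2
  have h3 : (‖x‖ ^ 2 - 2 * (⟪x, v⟫ / ‖v‖ ^ 2 * ⟪x, v⟫) + (⟪x, v⟫ / ‖v‖ ^ 2) ^ 2 * ‖v‖ ^ 2)
      * ‖v‖ ^ 2 = ‖x‖ ^ 2 * ‖v‖ ^ 2 - ⟪x, v⟫ ^ 2 := by
    field_simp
    ring
  rw [← h3]
  exact mul_pos h2 hv2

theorem line_far {V : Type*} [NormedAddCommGroup V] [InnerProductSpace ℝ V] {v x : V}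
    {R l : ℝ} (h : R ^ 2 * ‖x‖ ^ 2 < l ^ 2 * (‖x‖ ^ 2 * ‖v‖ ^ 2 - ⟪x, v⟫ ^ 2)) (t : ℝ) :
    R < ‖t • x + l • v‖ := by
  have h1 : ‖x‖ ^ 2 * ‖t • x + l • v‖ ^ 2 - ⟪x, t • x + l • v⟫ ^ 2
      = l ^ 2 * (‖x‖ ^ 2 * ‖v‖ ^ 2 - ⟪x, v⟫ ^ 2) := by
    rw [norm_add_sq_real, inner_add_right, inner_smul_right, inner_smul_right, inner_smul_right,
      inner_smul_left, real_inner_self_eq_norm_sq, norm_smul, norm_smul, mul_pow, mul_pow,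
      Real.norm_eq_abs, Real.norm_eq_abs, sq_abs, sq_abs]
    simp
    ring
  have h2 : R ^ 2 * ‖x‖ ^ 2 < ‖t • x + l • v‖ ^ 2 * ‖x‖ ^ 2 := by
    nlinarith [sq_nonneg ⟪x, t • x + l • v⟫]
  have h3 : R ^ 2 < ‖t • x + l • v‖ ^ 2 := lt_of_mul_lt_mul_right h2 (sq_nonneg _)
  exact (abs_lt_of_sq_lt_sq h3 (norm_nonneg _)).trans_le' (le_abs_self R)

section FT2
variable {V : Type*} [NormedAddCommGroup V] [InnerProductSpace ℝ V] [FiniteDimensional ℝ V]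
  [MeasurableSpace V] [BorelSpace V]

theorem ftc_conj (w : V → ℂ) (y : V) :
    ftc (fun z => (starRingEnd ℂ) (w z)) y = (starRingEnd ℂ) (ftc w (-y)) := by
  unfold ftc
  rw [← integral_conj]
  congr 1
  ext z
  rw [map_mul, ← Complex.exp_conj]
  simp

theorem ftc_re {w : V → ℂ} (hw : Integrable w) (y : V) :
    ftc (fun z => ((w z).re : ℂ)) y = (ftc w y + (starRingEnd ℂ) (ftc w (-y))) / 2 := by
  rw [← ftc_conj]
  have hc : Integrable (fun z => (starRingEnd ℂ) (w z)) :=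
    (Complex.conjLIE.toContinuousLinearEquiv : ℂ →L[ℝ] ℂ).integrable_comp hw
  have h1 := ftc_integrable hw y
  have h2 := ftc_integrable hc y
  unfold ftc
  rw [← integral_add h1 h2, ← integral_div]
  congr 1
  ext z
  beta_reduce
  rw [Complex.re_eq_add_conj]
  ring

theorem ftc_im {w : V → ℂ} (hw : Integrable w) (y : V) :
    ftc (fun z => ((w z).im : ℂ)) y
      = (ftc w y - (starRingEnd ℂ) (ftc w (-y))) / (2 * Complex.I) := by
  rw [← ftc_conj]
  have hc : Integrable (fun z => (starRingEnd ℂ) (w z)) :=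
    (Complex.conjLIE.toContinuousLinearEquiv : ℂ →L[ℝ] ℂ).integrable_comp hw
  have h1 := ftc_integrable hw y
  have h2 := ftc_integrable hc y
  unfold ftc
  rw [← integral_sub h1 h2, ← integral_div]
  congr 1
  ext z
  beta_reduce
  rw [Complex.im_eq_sub_conj]
  ring

theorem ftc_mod (h : V → ℂ) (ε : ℂ) (b y : V) :
    ftc (fun z => ε * (Complex.exp ((⟪b, z⟫ : ℝ) * Complex.I) * h z)) y = ε * ftc h (y + b) := by
  unfold ftc
  rw [← integral_const_mul]
  congr 1
  ext z
  rw [inner_add_left]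
  push_cast
  rw [add_mul, Complex.exp_add]
  ring
end FT2

/-- **sharpness.** Let `T : ℝ^d → ℝ^d` (`d ≥ 2`) be linear with `T ≠ I` but
`T^n = I` for some `n ≥ 2`, and let `(M_N)` be positive with `M_0 = 1`,
`M_N² ≤ M_{N-1} M_{N+1}`, and `∑_{N≥1} M_N^{-1/N} < ∞`. Then there is a Borel probability
measure `P` on `ℝ^d` with `∫ ‖x‖^N dP ≤ M_N` for all `N`, `E(P, PT⁻¹)` of positive Lebesgue
measure, and yet `P T⁻¹ ≠ P`. -/
theorem sharpness
    {d n : ℕ} (hd : 2 ≤ d) (hn : 2 ≤ n)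
    (T : EuclideanSpace ℝ (Fin d) →ₗ[ℝ] EuclideanSpace ℝ (Fin d))
    (hT1 : T ≠ LinearMap.id) (hTn : T ^ n = LinearMap.id)
    (M : ℕ → ℝ) (hMpos : ∀ N, 0 < M N) (hM0 : M 0 = 1)
    (hMlogconvex : ∀ N : ℕ, 1 ≤ N → M N ^ 2 ≤ M (N - 1) * M (N + 1))
    (hMsum : Summable fun N : ℕ => M (N + 1) ^ (-1 / ((N : ℝ) + 1))) :
    ∃ P : Measure (EuclideanSpace ℝ (Fin d)), IsProbabilityMeasure P ∧
      (∀ N : ℕ, ∫⁻ x, (‖x‖₊ : ℝ≥0∞) ^ N ∂P ≤ ENNReal.ofReal (M N)) ∧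
      0 < volume (eqCharFnSet P (P.map ⇑T)) ∧
      P.map ⇑T ≠ P := by
  set S := LinearMap.adjoint T with hS
  -- a vector moved by the adjoint
  obtain ⟨v, hv⟩ : ∃ v, S v ≠ v := by
    by_contra! hall
    apply hT1
    ext1 z
    refine ext_inner_left ℝ fun y => ?_
    rw [← LinearMap.adjoint_inner_left, ← hS, hall, LinearMap.id_apply]
  have hv0 : v ≠ 0 := by rintro rfl; exact hv (map_zero S)
  have hSinj : Function.Bijective S := by
    have h1 : ∀ y, (S ^ n) y = y := by
      intro y
      refine ext_inner_right ℝ fun z => ?_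
      rw [hS, ← pow_inner, hTn, LinearMap.id_apply]
    obtain ⟨m, rfl⟩ : ∃ m, n = m + 1 := ⟨n - 1, by omega⟩
    constructor
    · intro a b hab
      rw [← h1 a, ← h1 b, pow_succ, Module.End.mul_apply, Module.End.mul_apply, hab]
    · intro a
      refine ⟨(S ^ m) a, ?_⟩
      rw [← Module.End.mul_apply, ← pow_succ', h1]
  -- a line avoiding both spans
  have hspan : Submodule.span ℝ {v} ≠ ⊤ := by
    intro h
    have h1 := finrank_span_singleton (K := ℝ) hv0
    rw [h, finrank_top, finrank_euclideanSpace, Fintype.card_fin] at h1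
    omega
  have hspan2 : (Submodule.span ℝ {v}).comap S ≠ ⊤ := by
    intro h
    apply hspan
    rw [eq_top_iff]
    intro a _
    obtain ⟨b, rfl⟩ := hSinj.2 a
    have : b ∈ (Submodule.span ℝ {v}).comap S := by rw [h]; trivial
    exact this
  obtain ⟨x0, hx1, hx2⟩ : ∃ x0, x0 ∉ Submodule.span ℝ {v} ∧ S x0 ∉ Submodule.span ℝ {v} := by
    by_contra! hall
    have h1 := Measure.addHaar_submodule
      (volume : Measure (EuclideanSpace ℝ (Fin d))) _ hspan
    have h2 := Measure.addHaar_submodule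
      (volume : Measure (EuclideanSpace ℝ (Fin d))) _ hspan2
    have h3 := measure_union_null h1 h2
    have h4 : ((Submodule.span ℝ {v} : Set (EuclideanSpace ℝ (Fin d))) ∪
        ((Submodule.span ℝ {v}).comap S : Submodule ℝ (EuclideanSpace ℝ (Fin d)))) = Set.univ := by
      ext z
      simp only [Set.mem_union, SetLike.mem_coe, Submodule.mem_comap, Set.mem_univ, iff_true]
      by_cases hz : z ∈ Submodule.span ℝ {v}
      · exact Or.inl hz
      · exact Or.inr (hall z hz)
    rw [h4] at h3
    exact isOpen_univ.measure_ne_zero volume Set.univ_nonempty h3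
  have hq1 := gram_pos hv0 hx1
  have hq2 := gram_pos hv0 hx2
  -- uniform bound for the powers of T
  obtain ⟨B, hBpos, hB⟩ : ∃ B : ℝ, 0 < B ∧ ∀ j < n, ∀ z, ‖(T ^ j) z‖ ≤ B * ‖z‖ := by
    refine ⟨1 + ∑ j ∈ Finset.range n, ‖LinearMap.toContinuousLinearMap (T ^ j)‖,
      by positivity, fun j hj z => ?_⟩
    refine ((LinearMap.toContinuousLinearMap (T ^ j)).le_opNorm z).trans ?_
    refine mul_le_mul_of_nonneg_right ?_ (norm_nonneg _)
    have := Finset.single_le_sum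
      (f := fun j => ‖LinearMap.toContinuousLinearMap (T ^ j)‖) (fun _ _ => norm_nonneg _)
      (Finset.mem_range.mpr hj)
    simp only at this
    linarith
  obtain ⟨h, k, hh, hk, hhk, ⟨R, hR⟩, y0, hy0⟩ :=
    exists_h (by omega : 1 ≤ d) B hBpos M hMpos hM0 hMlogconvex hMsum
  -- choice of the frequency
  obtain ⟨l, hl1, hl2, hl3⟩ : ∃ l : ℝ,
      R ^ 2 * ‖x0‖ ^ 2 < l ^ 2 * (‖x0‖ ^ 2 * ‖v‖ ^ 2 - ⟪x0, v⟫ ^ 2) ∧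
      R ^ 2 * ‖S x0‖ ^ 2 < l ^ 2 * (‖S x0‖ ^ 2 * ‖v‖ ^ 2 - ⟪S x0, v⟫ ^ 2) ∧
      R + ‖S y0‖ < l * ‖v - S v‖ := by
    have hsq : Filter.Tendsto (fun l : ℝ => l ^ 2) Filter.atTop Filter.atTop :=
      Filter.tendsto_pow_atTop two_ne_zero
    have e1 := (hsq.atTop_mul_const hq1).eventually_gt_atTop (R ^ 2 * ‖x0‖ ^ 2)
    have e2 := (hsq.atTop_mul_const hq2).eventually_gt_atTop (R ^ 2 * ‖S x0‖ ^ 2)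
    have hne : 0 < ‖v - S v‖ := norm_pos_iff.mpr (sub_ne_zero.mpr hv.symm)
    have e3 := (Filter.tendsto_id.atTop_mul_const hne).eventually_gt_atTop (R + ‖S y0‖)
    exact (e1.and (e2.and e3)).exists
  have hScont : Continuous S := LinearMap.continuous_of_finiteDimensional S
  let U : Set (EuclideanSpace ℝ (Fin d)) :=
    {x | R ^ 2 * ‖x‖ ^ 2 < l ^ 2 * (‖x‖ ^ 2 * ‖v‖ ^ 2 - ⟪x, v⟫ ^ 2)} ∩
    {x | R ^ 2 * ‖S x‖ ^ 2 < l ^ 2 * (‖S x‖ ^ 2 * ‖v‖ ^ 2 - ⟪S x, v⟫ ^ 2)}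
  have hUopen : IsOpen U :=
    (isOpen_lt (by fun_prop) (by fun_prop)).inter (isOpen_lt (by fun_prop) (by fun_prop))
  have hUpos : 0 < volume U := hUopen.measure_pos volume ⟨x0, hl1, hl2⟩
  -- the perturbation
  have hnpos : (0:ℝ) < n := by positivity
  let K : ℝ := ∫ z, ‖k z‖
  have hK : 0 ≤ K := integral_nonneg fun _ => norm_nonneg _
  let ε : ℝ := (n * (K + 1))⁻¹
  have hε : 0 < ε := by positivity
  let w : EuclideanSpace ℝ (Fin d) → ℂ := fun z =>
    (ε : ℂ) * (Complex.exp ((⟪l • v, z⟫ : ℝ) * Complex.I) * h z)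
  have hw : Integrable w := (ftc_integrable hh (l • v)).const_mul _
  have hwft : ∀ y, ftc w y = ε * ftc h (y + l • v) := fun y => ftc_mod h ε (l • v) y
  have hwnorm : ∀ z, ‖w z‖ = ε * ‖h z‖ := by
    intro z
    simp only [w]
    rw [norm_mul, norm_mul, Complex.norm_exp_ofReal_mul_I, one_mul, Complex.norm_real,
      Real.norm_of_nonneg hε.le]
  have hkε : Integrable (fun z => ε * ‖k z‖) := hk.norm.const_mul _
  have hkε1 : ∫ z, ε * ‖k z‖ ≤ (n : ℝ)⁻¹ := by
    rw [integral_const_mul]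
    change (n * (K + 1))⁻¹ * K ≤ _
    rw [mul_inv, mul_assoc]
    refine mul_le_of_le_one_right (by positivity) ?_
    rw [inv_mul_le_iff₀ (by positivity)]
    linarith
  have hbound : ∀ g : EuclideanSpace ℝ (Fin d) → ℝ, (∀ z, |g z| ≤ ‖w z‖) →
      ∀ N z, (B * ‖z‖) ^ N * |g z| ≤ M N * (ε * ‖k z‖) := by
    intro g hg N z
    calc (B * ‖z‖) ^ N * |g z| ≤ (B * ‖z‖) ^ N * (ε * ‖h z‖) := by
          rw [← hwnorm]
          exact mul_le_mul_of_nonneg_left (hg z) (by positivity)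
      _ = ε * ((B * ‖z‖) ^ N * ‖h z‖) := by ring
      _ ≤ ε * (M N * ‖k z‖) := mul_le_mul_of_nonneg_left (hhk N z) hε.le
      _ = _ := by ring
  -- vanishing along lines
  have hvan : ∀ x, R ^ 2 * ‖x‖ ^ 2 < l ^ 2 * (‖x‖ ^ 2 * ‖v‖ ^ 2 - ⟪x, v⟫ ^ 2) →
      ∀ t : ℝ, ftc w (t • x) = 0 := by
    intro x hx t
    rw [hwft, hR _ (line_far hx t), mul_zero]
  have hvan_re : ∀ x, R ^ 2 * ‖x‖ ^ 2 < l ^ 2 * (‖x‖ ^ 2 * ‖v‖ ^ 2 - ⟪x, v⟫ ^ 2) →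
      ∀ t : ℝ, ftc (fun z => ((w z).re : ℂ)) (t • x) = 0 := by
    intro x hx t
    rw [ftc_re hw, ← neg_smul, hvan x hx, hvan x hx]
    simp
  have hvan_im : ∀ x, R ^ 2 * ‖x‖ ^ 2 < l ^ 2 * (‖x‖ ^ 2 * ‖v‖ ^ 2 - ⟪x, v⟫ ^ 2) →
      ∀ t : ℝ, ftc (fun z => ((w z).im : ℂ)) (t • x) = 0 := by
    intro x hx t
    rw [ftc_im hw, ← neg_smul, hvan x hx, hvan x hx]
    simp
  -- non-invariance
  have hne : ftc w (S (y0 - l • v)) ≠ ftc w (y0 - l • v) := by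
    have h1 : ftc w (y0 - l • v) ≠ 0 := by
      rw [hwft, sub_add_cancel]
      exact mul_ne_zero (by exact_mod_cast hε.ne') hy0
    have h2 : ftc w (S (y0 - l • v)) = 0 := by
      rw [hwft, hR, mul_zero]
      have e1 : l • (v - S v) = (S (y0 - l • v) + l • v) - S y0 := by
        rw [map_sub, map_smul, smul_sub]; abel
      have e2 := norm_sub_le (S (y0 - l • v) + l • v) (S y0)
      rw [← e1, norm_smul] at e2
      have e3 := mul_le_mul_of_nonneg_right (le_abs_self l) (norm_nonneg (v - S v))
      rw [Real.norm_eq_abs] at e2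
      linarith
    rw [h2]
    exact h1.symm
  obtain ⟨P1, hP1, hmom1, hdiff1⟩ := exists_P hn T hTn B hB M hMpos hM0
    (fun z => (w z).re) (fun z => ε * ‖k z‖) hw.re hkε hkε1 (fun z => by positivity)
    (hbound _ fun z => Complex.abs_re_le_norm _)
  obtain ⟨P2, hP2, hmom2, hdiff2⟩ := exists_P hn T hTn B hB M hMpos hM0
    (fun z => (w z).im) (fun z => ε * ‖k z‖) hw.im hkε hkε1 (fun z => by positivity)
    (hbound _ fun z => Complex.abs_im_le_norm _)
  by_cases hinv1 : P1.map ⇑T = P1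
  · refine ⟨P2, hP2, hmom2, hUpos.trans_le (measure_mono ?_), ?_⟩
    · intro x hx t
      have := hdiff2 (t • x)
      rw [map_smul, hvan_im x hx.1, hvan_im (S x) hx.2, sub_zero] at this
      exact sub_eq_zero.mp this
    · intro hinv2
      apply hne
      have e1 := hdiff1 (y0 - l • v)
      have e2 := hdiff2 (y0 - l • v)
      rw [hinv1, sub_self, ← hS, ftc_re hw, ftc_re hw] at e1
      rw [hinv2, sub_self, ← hS, ftc_im hw, ftc_im hw] at e2
      field_simp at e1 e2
      linear_combination (e1 + e2) / 2
  · refine ⟨P1, hP1, hmom1, hUpos.trans_le (measure_mono ?_), hinv1⟩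
    intro x hx t
    have := hdiff1 (t • x)
    rw [map_smul, hvan_re x hx.1, hvan_re (S x) hx.2, sub_zero] at this
    exact sub_eq_zero.mp this
end
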